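/- Let A = kQ/I be a non simply connected toupie algebra with dim_k e_0 A e_∞ = 0. Then A is weakly shod. -/

import Mathlib

/-!
Formalization preamble for "Toupie algebras".

We realize the bound quiver algebra `A = kQ/I` of a toupie quiver `Q` concretely:
the path algebra `kQ` is realized, via its (faithful) left regular representation,
as the subalgebra of `Module.End k (paths → k)` generated by the operators of left
multiplication by the trivial paths `e_v` and by the arrows of `Q`.  Paths are
composed from left to right (`p * q` = "first `p`, then `q`"), as in
Assem–Simson–Skowroński, so that paths from the source `0` to the sink `∞` span
`e₀ (kQ) e∞`, and (right) `A`-modules are identified with representations of `(Q, I)`.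
Right `A`-modules are formalized as (left) modules over `Aᵐᵒᵖ`.
-/

set_option synthInstance.maxHeartbeats 400000
set_option maxHeartbeats 800000

noncomputable section
open scoped Classical
open MulOpposite

universe u

namespace Toupie

/-- Vertices of a toupie quiver with `t` branches, branch `i` having length `ℓ i ≥ 1`:
the unique source `src`, the unique sink `snk`, and for each branch `i` its interior
vertices `mid i a` (the `(a+1)`-st vertex on branch `i`, for `a : Fin (ℓ i - 1)`). -/
inductive Vtx (t : ℕ) (ℓ : Fin t → ℕ) : Type
  | src : Vtx t ℓ
  | snk : Vtx t ℓ
  | mid (i : Fin t) (a : Fin (ℓ i - 1)) : Vtx t ℓ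

/-- The `a`-th vertex on branch `i`, for `0 ≤ a ≤ ℓ i`
(`a = 0` is the source, `a = ℓ i` is the sink). -/
def vtx (t : ℕ) (ℓ : Fin t → ℕ) (i : Fin t) (a : ℕ) : Vtx t ℓ :=
  if a = 0 then .src else if h : a - 1 < ℓ i - 1 then .mid i ⟨a - 1, h⟩ else .snk

/-- The paths of a toupie quiver: trivial paths at the vertices, and for each branch
`i` and `a < b ≤ ℓ i` the path `sub i a b` along branch `i` from its `a`-th vertex to
its `b`-th vertex.  (`sub i 0 (ℓ i)` is the `i`-th branch `w i`.) -/
inductive PIdx (t : ℕ) (ℓ : Fin t → ℕ) : Type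
  | vert (v : Vtx t ℓ) : PIdx t ℓ
  | sub (i : Fin t) (a b : ℕ) (hab : a < b) (hb : b ≤ ℓ i) : PIdx t ℓ

variable (k : Type u) [Field k] (t : ℕ) (ℓ : Fin t → ℕ)

/-- The vector space with basis the set of paths of the toupie quiver. -/
abbrev PSp : Type u := PIdx t ℓ → k

variable {t ℓ}

/-- The starting vertex of a path. -/
def startIdx : PIdx t ℓ → Vtx t ℓ
  | .vert v => v
  | .sub i a _ _ _ => vtx t ℓ i a

/-- Left multiplication by the trivial path (primitive idempotent) `e_v`. -/
def Ev (v : Vtx t ℓ) : Module.End k (PSp k t ℓ) where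
  toFun f := fun p => if startIdx p = v then f p else 0
  map_add' f g := by funext p; by_cases h : startIdx p = v <;> simp [h]
  map_smul' c f := by funext p; by_cases h : startIdx p = v <;> simp [h]

/-- Strip the `j`-th arrow of branch `i` (the arrow `vtx i j ⟶ vtx i (j+1)`) from the
front of a path, if possible. -/
def strip (i : Fin t) (j : ℕ) : PIdx t ℓ → Option (PIdx t ℓ)
  | .vert _ => none
  | .sub i' a b _ hb =>
      if h : i' = i ∧ a = j then
        if hb2 : j + 1 < b then some (.sub i (j + 1) b hb2 (h.1 ▸ hb))
        else some (.vert (vtx t ℓ i b))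
      else none

/-- Left multiplication by the `j`-th arrow of branch `i`
(the arrow from `vtx i j` to `vtx i (j+1)`, for `j < ℓ i`; the zero operator for junk `j`). -/
def Ar (i : Fin t) (j : ℕ) : Module.End k (PSp k t ℓ) where
  toFun f := fun p => (strip i j p).elim 0 f
  map_add' f g := by funext p; rcases h : strip i j p with _ | q <;> simp [h]
  map_smul' c f := by funext p; rcases h : strip i j p with _ | q <;> simp [h]

variable (t ℓ)

/-- The generators of the path algebra: the trivial paths and the arrows. -/
def gens : Set (Module.End k (PSp k t ℓ)) :=
  Set.range (Ev k) ∪ {x | ∃ i j, x = Ar k i j}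

/-- The path algebra `kQ` of the toupie quiver, realized as the subalgebra of
`Module.End k (PSp k t ℓ)` generated by left multiplication by trivial paths and arrows. -/
def PathAlg : Subalgebra k (Module.End k (PSp k t ℓ)) :=
  Algebra.adjoin k (gens k t ℓ)

variable {k t ℓ}

/-- The trivial path `e_v` as an element of the path algebra. -/
def eV (v : Vtx t ℓ) : PathAlg k t ℓ :=
  ⟨Ev k v, Algebra.subset_adjoin (Or.inl ⟨v, rfl⟩)⟩

/-- The `j`-th arrow of branch `i` as an element of the path algebra. -/
def arE (i : Fin t) (j : ℕ) : PathAlg k t ℓ :=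
  ⟨Ar k i j, Algebra.subset_adjoin (Or.inr ⟨i, j, rfl⟩)⟩

/-- The path along branch `i` from its `a`-th vertex to its `b`-th vertex, as an element
of the path algebra: the product (composed from left to right) of the arrows
`a → a+1 → ⋯ → b`.  (For `b ≤ a` this is the empty product `1`.) -/
def subE (i : Fin t) (a b : ℕ) : PathAlg k t ℓ :=
  (((List.range (b - a)).map fun s => arE i (a + s)).prod)

/-- The `i`-th branch `w i` (the path from the source to the sink along branch `i`)
as an element of the path algebra. -/
def wE (i : Fin t) : PathAlg k t ℓ := subE i 0 (ℓ i)

variable {k : Type u} [Field k]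

/-- A toupie algebra `A = kQ/I`: a toupie quiver `Q` (a non-linear quiver with a unique
source, a unique sink, and all other vertices having exactly one incoming and one
outgoing arrow, i.e. `t ≥ 2` branches of lengths `ℓ i ≥ 1`), together with an admissible
ideal `I` of the path algebra `kQ`.  Since `Q` is finite and acyclic, the arrow ideal is
nilpotent, so admissibility amounts to `I ⊆ R_Q²`, i.e. every element of `I` is a linear
combination of paths of length `≥ 2`. -/
structure ToupieAlg (k : Type u) [Field k] : Type u where
  t : ℕ
  ht : 2 ≤ t
  ℓ : Fin t → ℕ
  hℓ : ∀ i, 1 ≤ ℓ i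
  I : TwoSidedIdeal (PathAlg k t ℓ)
  adm : ∀ x ∈ I, x ∈ Submodule.span k
    {y : PathAlg k t ℓ | ∃ i a b, a + 2 ≤ b ∧ b ≤ ℓ i ∧ y = subE i a b}

variable (T : ToupieAlg k)

/-- The underlying algebra `A = kQ/I` of a toupie algebra. -/
def Alg : Type u := T.I.ringCon.Quotient

instance : Ring (Alg T) := inferInstanceAs (Ring T.I.ringCon.Quotient)

/-- The quotient map `kQ → A = kQ/I`. -/
def mkA : PathAlg k T.t T.ℓ →+* Alg T := T.I.ringCon.mk'

lemma mkA_surjective : Function.Surjective (mkA T) := Quotient.mk''_surjective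

instance : Algebra k (Alg T) :=
  RingHom.toAlgebra' ((mkA T).comp (algebraMap k (PathAlg k T.t T.ℓ)))
    (by
      intro c x
      obtain ⟨y, rfl⟩ := mkA_surjective T x
      simp only [RingHom.coe_comp, Function.comp_apply, ← map_mul]
      rw [Algebra.commutes])

/-- The idempotent `e₀` (at the source) in `A`. -/
def e0 : Alg T := mkA T (eV Vtx.src)

/-- The idempotent `e∞` (at the sink) in `A`. -/
def einf : Alg T := mkA T (eV Vtx.snk)

/-- The `k`-linear map `A → A`, `x ↦ e₀ * x * e∞`, whose range is `e₀ A e∞`. -/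
def lrMap : Alg T →ₗ[k] Alg T where
  toFun x := e0 T * x * einf T
  map_add' x y := by simp [mul_add, add_mul]
  map_smul' c x := by
    simp only [RingHom.id_apply]
    rw [mul_smul_comm, smul_mul_assoc]

/-- `m = dim_k e₀ A e∞`, the dimension of the span of the (residues of the) paths from
the source to the sink. -/
def mDim : ℕ := Module.finrank k ↥(LinearMap.range (lrMap T))

/-- The branch `w i` lies in the ideal `I`. -/
def branchInI (i : Fin T.t) : Prop := wE i ∈ T.I

/-- A minimal relation: `∑_{i ∈ J} λ i • w i ∈ I` with `|J| ≥ 2`, all `λ i ≠ 0`, and no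
nonempty proper subsum in `I`. -/
def MinRel (J : Finset (Fin T.t)) (lam : Fin T.t → k) : Prop :=
  2 ≤ J.card ∧ (∀ i ∈ J, lam i ≠ 0) ∧ (∑ i ∈ J, lam i • wE i) ∈ T.I ∧
    ∀ J' ⊂ J, J'.Nonempty → (∑ i ∈ J', lam i • wE i) ∉ T.I

/-- A toupie algebra is simply connected if any two distinct branches are involved in a
common minimal relation. -/
def SimplyConnected : Prop :=
  ∀ i j : Fin T.t, i ≠ j → ∃ J lam, MinRel T J lam ∧ i ∈ J ∧ j ∈ J

/-- A (minimal) zero-relation on branch `i`: the subpath of branch `i` from its `a`-th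
to its `b`-th vertex lies in `I`, but no proper subpath of it does. -/
def ZeroRel (i : Fin T.t) (a b : ℕ) : Prop :=
  a < b ∧ b ≤ T.ℓ i ∧ subE i a b ∈ T.I ∧
    ∀ a' b', a ≤ a' → b' ≤ b → a' < b' → (a', b') ≠ (a, b) → subE i a' b' ∉ T.I

/-- There is exactly one relation on branch `i`. -/
def ExactlyOneRel (i : Fin T.t) : Prop := ∃! p : ℕ × ℕ, ZeroRel T i p.1 p.2

/-- Branch `i` carries more than one relation. -/
def MoreThanOneRel (i : Fin T.t) : Prop :=
  ∃ p q : ℕ × ℕ, p ≠ q ∧ ZeroRel T i p.1 p.2 ∧ ZeroRel T i q.1 q.2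

/-- At most one branch of `Q` has length at least three. -/
def AtMostOneLongBranch : Prop := ∀ i j : Fin T.t, 3 ≤ T.ℓ i → 3 ≤ T.ℓ j → i = j

/-- The two-sided ideal `I` is generated by the set `S`. -/
def IsGenBy {R : Type u} [Ring R] (I : TwoSidedIdeal R) (S : Set R) : Prop :=
  S ⊆ (I : Set R) ∧ ∀ J : TwoSidedIdeal R, S ⊆ (J : Set R) → (I : Set R) ⊆ (J : Set R)

/-- A toupie algebra is canonical if (after choosing two distinguished branches `i₁, i₂`)
its ideal is generated by `{w i₁ + λ j • w i₂ - w j}` over the remaining branches `j`,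
with the `λ j` pairwise distinct and nonzero. -/
def IsCanonical : Prop :=
  ∃ (i₁ i₂ : Fin T.t) (lam : Fin T.t → k), i₁ ≠ i₂ ∧
    (∀ j, j ≠ i₁ → j ≠ i₂ → lam j ≠ 0) ∧
    (∀ j j', j ≠ i₁ → j ≠ i₂ → j' ≠ i₁ → j' ≠ i₂ → j ≠ j' → lam j ≠ lam j') ∧
    IsGenBy T.I {x | ∃ j, j ≠ i₁ ∧ j ≠ i₂ ∧ x = wE i₁ + lam j • wE i₂ - wE j}

end Toupie
namespace Toupie

/-! ### Module-theoretic notions over an arbitrary ring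

Following the paper, all modules are finite-dimensional *right* modules; a right
`A`-module is formalized as a (left) module over `Aᵐᵒᵖ`.  The definitions below are
stated for modules over an arbitrary ring `R` and are applied with `R := Aᵐᵒᵖ`. -/

variable (R : Type u) [Ring R]

/-- A module is indecomposable if it is nonzero and its only idempotent endomorphisms
are `0` and the identity. -/
def Indec (M : ModuleCat.{u} R) : Prop :=
  Nontrivial M ∧ ∀ f : M →ₗ[R] M, f.comp f = f → f = 0 ∨ f = LinearMap.id

/-- Finiteness ("finite dimensionality") of a module. -/
def FdMod (M : ModuleCat.{u} R) : Prop := Module.Finite R M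

/-- `M` has projective dimension at most one: it is the quotient of a projective module
by a projective submodule. -/
def PdLeOne (M : ModuleCat.{u} R) : Prop :=
  ∃ (P : ModuleCat.{u} R) (f : P →ₗ[R] M), Function.Surjective f ∧
    Module.Projective R P ∧ Module.Projective R ↥(LinearMap.ker f)

/-- `M` has injective dimension at most one: it embeds in an injective module with
injective cokernel. -/
def IdLeOne (M : ModuleCat.{u} R) : Prop :=
  ∃ (E : ModuleCat.{u} R) (f : M →ₗ[R] E), Function.Injective f ∧
    Module.Injective R E ∧ Module.Injective R (E ⧸ LinearMap.range f)

/-- One step of a path in `ind R`: a nonzero non-isomorphism between (finite-dimensional)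
indecomposable modules. -/
def Step (M N : ModuleCat.{u} R) : Prop :=
  Indec R M ∧ FdMod R M ∧ Indec R N ∧ FdMod R N ∧
    ∃ f : M →ₗ[R] N, f ≠ 0 ∧ ¬ Function.Bijective f

/-- A path in `ind R` from `M` to `N` (possibly trivial): a chain
`M = M₀ → M₁ → ⋯ → Mₙ = N` of nonzero non-isomorphisms between indecomposables. -/
def IndPath (M N : ModuleCat.{u} R) : Prop := Relation.ReflTransGen (Step R) M N

/-- The left part `L_R`: the indecomposable (finite-dimensional) modules `M` such that
every indecomposable `X` with a path `X ⇝ M` in `ind R` has projective dimension `≤ 1`. -/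
def InLeftPart (M : ModuleCat.{u} R) : Prop :=
  Indec R M ∧ FdMod R M ∧
    ∀ X : ModuleCat.{u} R, Indec R X → FdMod R X → IndPath R X M → PdLeOne R X

/-- The right part `R_R`: the indecomposable (finite-dimensional) modules `M` such that
every indecomposable `X` with a path `M ⇝ X` in `ind R` has injective dimension `≤ 1`. -/
def InRightPart (M : ModuleCat.{u} R) : Prop :=
  Indec R M ∧ FdMod R M ∧
    ∀ X : ModuleCat.{u} R, Indec R X → FdMod R X → IndPath R M X → IdLeOne R X

/-- Hereditary: global dimension at most one, i.e. every module has projective dimension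
at most one. -/
def Hereditary : Prop := ∀ M : ModuleCat.{u} R, PdLeOne R M

/-- Quasitilted: every indecomposable projective module lies in the left part. -/
def Quasitilted : Prop :=
  ∀ P : ModuleCat.{u} R, Indec R P → FdMod R P → Module.Projective R P → InLeftPart R P

/-- A module is directed if it lies on no cycle of nonzero non-isomorphisms between
indecomposables in `ind R`. -/
def Directed (M : ModuleCat.{u} R) : Prop := ¬ Relation.TransGen (Step R) M M

/-- Weakly shod: every indecomposable (finite-dimensional) module not lying in
`L_R ∪ R_R` is directed. -/
def WeaklyShod : Prop :=
  ∀ M : ModuleCat.{u} R, Indec R M → FdMod R M →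
    ¬ InLeftPart R M → ¬ InRightPart R M → Directed R M

/-- Laura: all but finitely many isomorphism classes of indecomposable
(finite-dimensional) modules lie in `L_R ∪ R_R`. -/
def Laura : Prop :=
  ∃ S : Set (ModuleCat.{u} R), S.Finite ∧
    ∀ M : ModuleCat.{u} R, Indec R M → FdMod R M →
      ¬ InLeftPart R M → ¬ InRightPart R M → ∃ N ∈ S, Nonempty (M ≃ₗ[R] N)

/-- There are exactly `n` isomorphism classes of modules satisfying `P`. -/
def NumClasses (P : ModuleCat.{u} R → Prop) (n : ℕ) : Prop :=
  ∃ f : Fin n → ModuleCat.{u} R, (∀ i, P (f i)) ∧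
    (∀ i j, Nonempty ((f i : Type u) ≃ₗ[R] (f j : Type u)) → i = j) ∧
    ∀ M : ModuleCat.{u} R, P M → ∃ i, Nonempty ((M : Type u) ≃ₗ[R] (f i : Type u))

/-- `M` is (isomorphic to) a direct summand of `T`. -/
def IsSummandOf (T : Type u) [AddCommGroup T] [Module R T] (M : ModuleCat.{u} R) : Prop :=
  ∃ N N' : Submodule R T, IsCompl N N' ∧ Nonempty ((M : Type u) ≃ₗ[R] N)

/-- `Ext¹_R(T, T) = 0`: every self-extension `0 → T → E → T → 0` splits. -/
def SelfExtVanish (T : Type u) [AddCommGroup T] [Module R T] : Prop :=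
  ∀ (E : Type u) [AddCommGroup E] [Module R E] (ι : T →ₗ[R] E) (π : E →ₗ[R] T),
    Function.Injective ι → Function.Surjective π → LinearMap.range ι = LinearMap.ker π →
      ∃ s : T →ₗ[R] E, π.comp s = LinearMap.id

/-- A tilting module over a hereditary algebra: a finite module with `Ext¹(T,T) = 0`
having as many pairwise non-isomorphic indecomposable direct summands as there are
simple modules. -/
def IsTiltingMod (T : Type u) [AddCommGroup T] [Module R T] : Prop :=
  Module.Finite R T ∧ SelfExtVanish R T ∧
    ∃ n : ℕ, NumClasses R (fun M => Indec R M ∧ IsSummandOf R T M) n ∧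
      NumClasses R (fun M => IsSimpleModule R M) n

variable (k : Type u) [Field k]

/-- A `k`-algebra `A` is tilted if it is the endomorphism algebra of a tilting (right)
module over a hereditary finite-dimensional `k`-algebra `H`.  (Right `H`-modules are
modules over `Hᵐᵒᵖ`; the isomorphism `A ≅ End_H T` is a `k`-linear ring isomorphism.) -/
def IsTilted (A : Type u) [Ring A] [Algebra k A] : Prop :=
  ∃ (H : Type u) (_ : Ring H) (_ : Algebra k H),
    FiniteDimensional k H ∧ Hereditary Hᵐᵒᵖ ∧
      ∃ (T : Type u) (_ : AddCommGroup T) (_ : Module Hᵐᵒᵖ T),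
        IsTiltingMod Hᵐᵒᵖ T ∧
          ∃ (_ : Module k T) (_ : SMulCommClass Hᵐᵒᵖ k T) (_ : IsScalarTower k Hᵐᵒᵖ T)
            (φ : A ≃+* Module.End Hᵐᵒᵖ T), ∀ (c : k) (x : A), φ (c • x) = c • φ x

end Toupie
namespace Toupie

variable {k : Type u} [Field k] (T : ToupieAlg k)

/-! ### Right `A`-modules as representations of `(Q, I)`

For a right `A`-module `M` (a module over `Aᵐᵒᵖ`) and a vertex `v`, the space of the
corresponding representation at `v` is `M_v = M • e_v`. -/

/-- The action of the idempotent `e_v ∈ A` on a right `A`-module (= `Aᵐᵒᵖ`-module). -/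
def actV (v : Vtx T.t T.ℓ) : (Alg T)ᵐᵒᵖ := op (mkA T (eV v))

/-- The space `M_v = M • e_v` of the representation `M` at the vertex `v` is zero. -/
def VanishAt (M : ModuleCat.{u} (Alg T)ᵐᵒᵖ) (v : Vtx T.t T.ℓ) : Prop :=
  ∀ m : M, actV T v • m = 0

/-- Every simple summand of `top M = M / rad M` is one of the simple modules `S_v`,
`v ∈ vs`: for every maximal submodule `N` the simple quotient `M/N` is supported at some
vertex of `vs` (for an admissible quotient of a path algebra, the simple module `S_v` is
the unique simple on which `e_v` acts nontrivially). -/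
def TopIn (M : ModuleCat.{u} (Alg T)ᵐᵒᵖ) (vs : Set (Vtx T.t T.ℓ)) : Prop :=
  ∀ N : Submodule (Alg T)ᵐᵒᵖ M, IsCoatom N → ∃ v ∈ vs, ∃ m : M, actV T v • m ∉ N

/-- Every simple summand of the socle of `M` is one of the simple modules `S_v`,
`v ∈ vs`: every simple submodule `N ≤ M` is supported at some vertex of `vs`. -/
def SocIn (M : ModuleCat.{u} (Alg T)ᵐᵒᵖ) (vs : Set (Vtx T.t T.ℓ)) : Prop :=
  ∀ N : Submodule (Alg T)ᵐᵒᵖ M, IsAtom N → ∃ v ∈ vs, ∃ m ∈ N, actV T v • m ≠ 0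

/-- The module `D x y` (for two positions `0 ≤ x, y ≤ ℓ i₀` on the unique branch `i₀`
lying in `I`, and an auxiliary branch `i₂ ≠ i₀`): the right `A`-module with generators
`g = e₀` (at the source) and `h = e_y` (at the `y`-th vertex of branch `i₀`), subject to
the relations `g ⬝ (subpath of w i₀ from 0 to x+1) = 0` and
`g ⬝ w i₂ = h ⬝ (subpath of w i₀ from y to ℓ i₀)`.  It is presented as the quotient of
the right regular module `A ⊕ A` by the right submodule generated by
`(1 - e₀, 0)`, `(0, 1 - e_y)`, `(subE i₀ 0 (min (x+1) (ℓ i₀)), 0)` and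
`(w i₂, - subE i₀ y (ℓ i₀))`. -/
abbrev Dmod (i₀ i₂ : Fin T.t) (x y : ℕ) : Type u :=
  (Alg T × Alg T) ⧸ Submodule.span (Alg T)ᵐᵒᵖ
    ({((mkA T (1 - eV Vtx.src) : Alg T), (0 : Alg T)),
      ((0 : Alg T), (mkA T (1 - eV (vtx T.t T.ℓ i₀ y)) : Alg T)),
      ((mkA T (subE i₀ 0 (min (x + 1) (T.ℓ i₀))) : Alg T), (0 : Alg T)),
      ((mkA T (wE i₂) : Alg T), (- mkA T (subE i₀ y (T.ℓ i₀)) : Alg T))} :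
        Set (Alg T × Alg T))

end Toupie

namespace Toupie

/-! ### Algebras generated by the vertices and arrows of an acyclic quiver -/

/-- The structure of an algebra generated by orthogonal idempotents `e v` (the vertices of an
acyclic quiver) and elements `a β` (its arrows), the arrow `β` acting on a left module as a
map from `e (s β) • M` to `e (t β) • M`. -/
structure AcyclicGen (k R V B : Type*) [Field k] [Ring R] [Algebra k R] [Fintype V] where
  e : V → R
  a : B → R
  s : B → V
  t : B → V
  rk : V → ℕ
  rk_lt : ∀ β, rk (s β) < rk (t β)
  e_mul : ∀ v w, e v * e w = if v = w then e v else 0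
  e_sum : ∑ v, e v = 1
  e_t_mul : ∀ β, e (t β) * a β = a β
  mul_e_s : ∀ β, a β * e (s β) = a β
  induction : ∀ P : R → Prop, (∀ c : k, P (algebraMap k R c)) → (∀ v, P (e v)) →
    (∀ β, P (a β)) → (∀ x y, P x → P y → P (x + y)) → (∀ x y, P x → P y → P (x * y)) →
    ∀ r, P r

namespace AcyclicGen

variable {k R V B : Type*} [Field k] [Ring R] [Algebra k R] [Fintype V]
  (G : AcyclicGen k R V B)

section Basic

variable {M : Type*} [AddCommGroup M] [Module R M]

lemma e_smul_e_smul (v w : V) (x : M) :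
    G.e v • G.e w • x = if v = w then G.e v • x else 0 := by
  rw [← mul_smul, G.e_mul]
  split_ifs <;> simp

lemma sum_e_smul (x : M) : ∑ v, G.e v • x = x := by
  rw [← Finset.sum_smul, G.e_sum, one_smul]

lemma e_smul_a_smul (v : V) (β : B) (x : M) :
    G.e v • G.a β • x = if v = G.t β then G.a β • x else 0 := by
  rw [← G.e_t_mul, mul_smul, G.e_smul_e_smul]
  split_ifs with h <;> simp [h]

lemma a_smul_e_smul (v : V) (β : B) (x : M) :
    G.a β • G.e v • x = if v = G.s β then G.a β • x else 0 := by
  rw [← G.mul_e_s, mul_smul, G.e_smul_e_smul]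
  by_cases h : v = G.s β
  · simp [h, mul_smul]
  · simp [h, Ne.symm h]

/-- A predicate on a module closed under addition, scalars, vertices and arrows defines a
submodule. -/
def submoduleOf [Module k M] [IsScalarTower k R M] (p : M → Prop) (h0 : p 0)
    (hadd : ∀ x y, p x → p y → p (x + y)) (hk : ∀ (c : k) x, p x → p (c • x))
    (he : ∀ v x, p x → p (G.e v • x)) (ha : ∀ β x, p x → p (G.a β • x)) : Submodule R M where
  carrier := {x | p x}
  add_mem' := fun {x y} hx hy => hadd x y hx hy
  zero_mem' := h0
  smul_mem' := by
    intro r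
    refine G.induction (fun r => ∀ {x : M}, p x → p (r • x)) ?_ ?_ ?_ ?_ ?_ r
    · intro c x hx
      rw [algebraMap_smul]
      exact hk c x hx
    · exact fun v x hx => he v x hx
    · exact fun β x hx => ha β x hx
    · intro r r' hr hr' x hx
      rw [add_smul]
      exact hadd _ _ (hr hx) (hr' hx)
    · intro r r' hr hr' x hx
      rw [mul_smul]
      exact hr (hr' hx)

lemma exists_linearMap [Module k M] [IsScalarTower k R M] {N : Type*} [AddCommGroup N]
    [Module R N] [Module k N] [IsScalarTower k R N] (h : M →ₗ[k] N)
    (he : ∀ v x, h (G.e v • x) = G.e v • h x) (ha : ∀ β x, h (G.a β • x) = G.a β • h x) :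
    ∃ h' : M →ₗ[R] N, ∀ x, h' x = h x := by
  refine ⟨{ toFun := h, map_add' := h.map_add, map_smul' := ?_ }, fun _ => rfl⟩
  intro r
  refine G.induction (fun r => ∀ x : M, h (r • x) = r • h x) ?_ he ha ?_ ?_ r
  · intro c x
    rw [algebraMap_smul, algebraMap_smul, h.map_smul]
  · intro r r' hr hr' x
    rw [add_smul, add_smul, h.map_add, hr, hr']
  · intro r r' hr hr' x
    rw [mul_smul, mul_smul, hr, hr']

end Basic

lemma exists_comp_eq_of_range_le {U U' U'' : Type*} [AddCommGroup U] [Module k U]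
    [AddCommGroup U'] [Module k U'] [AddCommGroup U''] [Module k U'']
    (f : U →ₗ[k] U'') (g : U' →ₗ[k] U'') (h : ∀ y, ∃ x, f x = g y) :
    ∃ s : U' →ₗ[k] U, ∀ y, f (s y) = g y := by
  obtain ⟨s, hs⟩ := Module.projective_lifting_property f.rangeRestrict
    (g.codRestrict (LinearMap.range f) fun y => h y) f.surjective_rangeRestrict
  exact ⟨s, fun y => congrArg Subtype.val (LinearMap.congr_fun hs y)⟩

lemma exists_comp_eq_of_ker_le {U U' U'' : Type*} [AddCommGroup U] [Module k U]
    [AddCommGroup U'] [Module k U'] [AddCommGroup U''] [Module k U'']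
    (f : U →ₗ[k] U') (g : U →ₗ[k] U'') (h : ∀ x, f x = 0 → g x = 0) :
    ∃ s : U' →ₗ[k] U'', ∀ x, s (f x) = g x := by
  obtain ⟨p, hp⟩ := f.rangeRestrict.exists_rightInverse_of_surjective f.range_rangeRestrict
  obtain ⟨q, hq⟩ := (g ∘ₗ p).exists_extend
  refine ⟨q, fun x => ?_⟩
  have h1 : q (f x) = g (p (f.rangeRestrict x)) := LinearMap.congr_fun hq (f.rangeRestrict x)
  have h2 : f (p (f.rangeRestrict x)) = f x :=
    congrArg Subtype.val (LinearMap.congr_fun hp (f.rangeRestrict x))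
  rw [h1, ← sub_eq_zero, ← map_sub]
  exact h _ (by rw [map_sub, h2, sub_self])

/-- Surjectivity, at the vertex `v`, of the map of a representation into the product over the
arrows starting at `v`. -/
def SurjAt (Y : Type*) [AddCommGroup Y] [Module R Y] (v : V) : Prop :=
  ∀ y : B → Y, ∃ x : Y, ∀ β, G.s β = v → G.a β • x = G.e (G.t β) • y β

/-- Injectivity, at the vertex `v`, of the map of a representation out of the direct sum over
the arrows ending at `v`. -/
def InjAt [Fintype B] (Y : Type*) [AddCommGroup Y] [Module R Y] (v : V) : Prop :=
  ∀ y : B → Y, ∑ β with G.t β = v, G.a β • y β = 0 → ∀ β, G.t β = v → G.e (G.s β) • y β = 0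

section Lifting

variable {Z W Y : Type*} [AddCommGroup Z] [Module R Z] [AddCommGroup W] [Module R W]
  [AddCommGroup Y] [Module R Y]

lemma exists_extension_step [Module k Z] [IsScalarTower k R Z] [Module k W] [IsScalarTower k R W]
    [Module k Y] [IsScalarTower k R Y] (f : Z →ₗ[R] W) (g : Z →ₗ[R] Y) (v : V)
    (hv : (∀ w, ∃ z, f z = G.e v • w) ∨ G.SurjAt Y v) (h : W →ₗ[k] Y)
    (hf : ∀ z, h (f z) = g z) (he : ∀ v w, h (G.e v • w) = G.e v • h w) :
    ∃ d : W →ₗ[k] Y, (∀ z, d (f z) = 0) ∧ (∀ w, G.e v • d w = d w) ∧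
      (∀ w, d (G.e v • w) = d w) ∧
      ∀ β, G.s β = v → ∀ w, G.a β • d w = h (G.a β • w) - G.a β • h w := by
  have key : ∀ β z, h (G.a β • f z) - G.a β • h (f z) = 0 := by
    intro β z
    rw [← f.map_smul, hf, hf, g.map_smul, sub_self]
  rcases hv with hv | hv
  · refine ⟨0, by simp, by simp, by simp, ?_⟩
    rintro β rfl w
    obtain ⟨z, hz⟩ := hv w
    have := key β z
    rw [hz, he, ← mul_smul, ← mul_smul, G.mul_e_s] at this
    simp [this]
  · let L : Y →ₗ[k] ({β : B // G.s β = v} → Y) :=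
      LinearMap.pi fun β => Algebra.lsmul k k Y (G.a β)
    let L' : (B → Y) →ₗ[k] ({β : B // G.s β = v} → Y) :=
      LinearMap.pi fun β => Algebra.lsmul k k Y (G.e (G.t β)) ∘ₗ LinearMap.proj β.1
    obtain ⟨s, hs⟩ := exists_comp_eq_of_range_le L L' fun y =>
      (hv y).imp fun x hx => funext fun β => hx β β.2
    have hs' : ∀ y β (_ : G.s β = v), G.a β • s y = G.e (G.t β) • y β :=
      fun y β hβ => congrFun (hs y) ⟨β, hβ⟩
    let C : W →ₗ[k] (B → Y) := LinearMap.pi fun β =>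
      h ∘ₗ Algebra.lsmul k k W (G.a β) - Algebra.lsmul k k Y (G.a β) ∘ₗ h
    have hC : ∀ w, C w = fun β => h (G.a β • w) - G.a β • h w := fun _ => rfl
    refine ⟨Algebra.lsmul k k Y (G.e v) ∘ₗ s ∘ₗ C ∘ₗ Algebra.lsmul k k W (G.e v), ?_, ?_, ?_, ?_⟩
    · intro z
      have : C (G.e v • f z) = 0 := by
        rw [← f.map_smul, hC]
        exact funext fun β => key β _
      simp [this]
    · intro w
      simp [G.e_smul_e_smul]
    · intro w
      simp [G.e_smul_e_smul]
    · rintro β rfl w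
      simp only [LinearMap.comp_apply, Algebra.lsmul_coe]
      rw [G.a_smul_e_smul, if_pos rfl, hs' _ _ rfl, hC]
      simp only
      rw [he, G.a_smul_e_smul, G.a_smul_e_smul, if_pos rfl, if_pos rfl, smul_sub, ← he,
        G.e_smul_a_smul, G.e_smul_a_smul, if_pos rfl, if_pos rfl]

lemma exists_lift_step [Fintype B] [Module k Z] [IsScalarTower k R Z] [Module k W]
    [IsScalarTower k R W] [Module k Y] [IsScalarTower k R Y] (f : W →ₗ[R] Z) (g : Y →ₗ[R] Z) (v : V)
    (hv : (∀ w, f (G.e v • w) = 0 → G.e v • w = 0) ∨ G.InjAt Y v) (h : Y →ₗ[k] W)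
    (hf : ∀ y, f (h y) = g y) (he : ∀ v y, h (G.e v • y) = G.e v • h y) :
    ∃ d : Y →ₗ[k] W, (∀ y, f (d y) = 0) ∧ (∀ y, G.e v • d y = d y) ∧
      (∀ y, d (G.e v • y) = d y) ∧
      ∀ β, G.t β = v → ∀ y, d (G.a β • y) = G.a β • h y - h (G.a β • y) := by
  have key : ∀ β y, f (G.a β • h y - h (G.a β • y)) = 0 := by
    intro β y
    rw [f.map_sub, f.map_smul, hf, hf, g.map_smul, sub_self]
  have key' : ∀ β y, G.e (G.t β) • (G.a β • h y - h (G.a β • y)) =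
      G.a β • h y - h (G.a β • y) := by
    intro β y
    rw [smul_sub, ← he, G.e_smul_a_smul, G.e_smul_a_smul, if_pos rfl, if_pos rfl]
  rcases hv with hv | hv
  · refine ⟨0, by simp, by simp, by simp, ?_⟩
    rintro β rfl y
    rw [← key', hv _ (by rw [key', key])]
    rfl
  · let L : (B → Y) →ₗ[k] Y :=
      ∑ β with G.t β = v, Algebra.lsmul k k Y (G.a β) ∘ₗ LinearMap.proj β
    let L' : (B → Y) →ₗ[k] (B → Y) := LinearMap.pi fun β =>
      if G.t β = v then Algebra.lsmul k k Y (G.e (G.s β)) ∘ₗ LinearMap.proj β else 0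
    have hL : ∀ y, L y = ∑ β with G.t β = v, G.a β • y β := fun y => by simp [L]
    have hL' : ∀ y β, L' y β = if G.t β = v then G.e (G.s β) • y β else 0 := fun y β => by
      simp only [L', LinearMap.pi_apply]
      split_ifs <;> rfl
    obtain ⟨s, hs⟩ := exists_comp_eq_of_ker_le L L' fun y hy => funext fun β => by
      rw [hL']
      split_ifs with hβ
      · exact hv y (by rw [← hL, hy]) β hβ
      · rfl
    have hs' : ∀ β (_ : G.t β = v) y, s (G.a β • y) = Pi.single β (G.e (G.s β) • y) := by
      intro β hβ y
      have h1 : L (Pi.single β y) = G.a β • y := by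
        rw [hL, Finset.sum_eq_single β]
        · simp
        · intro γ _ hγ
          simp [hγ]
        · simp [hβ]
      rw [← h1, hs]
      funext γ
      rw [hL']
      by_cases hγ : γ = β
      · subst hγ
        simp [hβ]
      · simp [hγ]
    let C : (B → Y) →ₗ[k] W := ∑ β with G.t β = v,
      (Algebra.lsmul k k W (G.a β) ∘ₗ h - h ∘ₗ Algebra.lsmul k k Y (G.a β)) ∘ₗ LinearMap.proj β
    have hC : ∀ y, C y = ∑ β with G.t β = v, (G.a β • h (y β) - h (G.a β • y β)) := fun y => by
      simp [C]
    refine ⟨Algebra.lsmul k k W (G.e v) ∘ₗ C ∘ₗ s ∘ₗ Algebra.lsmul k k Y (G.e v), ?_, ?_, ?_, ?_⟩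
    · intro y
      simp only [LinearMap.comp_apply, Algebra.lsmul_coe, hC, f.map_smul, map_sum, key,
        Finset.sum_const_zero, smul_zero]
    · intro w
      simp [G.e_smul_e_smul]
    · intro w
      simp [G.e_smul_e_smul]
    · intro β hβ y
      simp only [LinearMap.comp_apply, Algebra.lsmul_coe]
      rw [G.e_smul_a_smul, if_pos hβ.symm, hs' β hβ, hC, Finset.sum_eq_single β]
      · rw [← hβ, key', Pi.single_eq_same, he, G.a_smul_e_smul, G.a_smul_e_smul, if_pos rfl,
          if_pos rfl]
      · intro γ _ hγ
        simp [hγ]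
      · simp [hβ]

lemma exists_rk_le : ∃ N, ∀ v, G.rk v ≤ N :=
  ⟨Finset.univ.sup G.rk, fun v => Finset.le_sup (Finset.mem_univ v)⟩

lemma e_smul_sum_eq {W Y : Type*} [AddCommGroup W] [Module R W] [AddCommGroup Y] [Module R Y]
    [Module k W] [Module k Y]
    (d : V → W →ₗ[k] Y) (h1 : ∀ v w, G.e v • d v w = d v w) (u v : V) (w : W) :
    G.e u • d v w = if u = v then d v w else 0 := by
  rw [← h1, G.e_smul_e_smul]
  split_ifs with h <;> simp [h, h1]

lemma apply_e_smul_eq {W Y : Type*} [AddCommGroup W] [Module R W] [AddCommGroup Y] [Module R Y]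
    [Module k W] [Module k Y]
    (d : V → W →ₗ[k] Y) (h2 : ∀ v w, d v (G.e v • w) = d v w) (u v : V) (w : W) :
    d v (G.e u • w) = if u = v then d v w else 0 := by
  rw [← h2, G.e_smul_e_smul]
  split_ifs with h h' h' <;> simp_all

/-- The sum of the `k`-linear maps `e v ∘ h ∘ e v`. -/
def diag {W Y : Type*} [AddCommGroup W] [Module R W] [AddCommGroup Y] [Module R Y]
    [Module k W] [IsScalarTower k R W] [Module k Y] [IsScalarTower k R Y] (h : W →ₗ[k] Y) :
    W →ₗ[k] Y :=
  ∑ v, Algebra.lsmul k k Y (G.e v) ∘ₗ h ∘ₗ Algebra.lsmul k k W (G.e v)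

lemma diag_apply {W Y : Type*} [AddCommGroup W] [Module R W] [AddCommGroup Y] [Module R Y]
    [Module k W] [IsScalarTower k R W] [Module k Y] [IsScalarTower k R Y] (h : W →ₗ[k] Y) (w : W) :
    G.diag h w = ∑ v, G.e v • h (G.e v • w) := by
  simp [diag]

lemma diag_e_smul {W Y : Type*} [AddCommGroup W] [Module R W] [AddCommGroup Y] [Module R Y]
    [Module k W] [IsScalarTower k R W] [Module k Y] [IsScalarTower k R Y] (h : W →ₗ[k] Y)
    (u : V) (w : W) : G.diag h (G.e u • w) = G.e u • G.diag h w := by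
  rw [diag_apply, diag_apply, Finset.smul_sum]
  refine Finset.sum_congr rfl fun v _ => ?_
  rw [G.e_smul_e_smul, G.e_smul_e_smul]
  by_cases huv : v = u
  · simp [huv]
  · simp [huv, Ne.symm huv]

theorem exists_extension [Module k Z] [IsScalarTower k R Z] [Module k W] [IsScalarTower k R W]
    [Module k Y] [IsScalarTower k R Y] (f : Z →ₗ[R] W) (hf : Function.Injective f)
    (g : Z →ₗ[R] Y) (H : ∀ v, (∀ w, ∃ z, f z = G.e v • w) ∨ G.SurjAt Y v) :
    ∃ h : W →ₗ[R] Y, ∀ z, h (f z) = g z := by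
  obtain ⟨N, hN⟩ := G.exists_rk_le
  have key : ∀ n, ∃ h : W →ₗ[k] Y, (∀ z, h (f z) = g z) ∧
      (∀ v w, h (G.e v • w) = G.e v • h w) ∧
      ∀ β, N < G.rk (G.s β) + n → ∀ w, h (G.a β • w) = G.a β • h w := by
    intro n
    induction n with
    | zero =>
      obtain ⟨p, hp⟩ := (f.restrictScalars k).exists_leftInverse_of_injective
        (LinearMap.ker_eq_bot.mpr hf)
      have hp' : ∀ z, p (f z) = z := fun z => LinearMap.congr_fun hp z
      refine ⟨G.diag (g.restrictScalars k ∘ₗ p), fun z => ?_, fun v w => G.diag_e_smul _ v w,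
        fun β hβ => absurd (hN (G.s β)) (by omega)⟩
      rw [diag_apply]
      conv_rhs => rw [← G.sum_e_smul (g z)]
      refine Finset.sum_congr rfl fun v _ => ?_
      rw [← f.map_smul, LinearMap.comp_apply, hp', LinearMap.restrictScalars_apply, g.map_smul,
        G.e_smul_e_smul, if_pos rfl]
    | succ n ih =>
      obtain ⟨h, h1, h2, h3⟩ := ih
      choose d d1 d2 d3 d4 using fun v => G.exists_extension_step f g v (H v) h h1 h2
      have hd : ∀ w, (∑ v with G.rk v + n = N, d v) w = ∑ v with G.rk v + n = N, d v w := by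
        intro w
        simp
      refine ⟨h + ∑ v with G.rk v + n = N, d v, ?_, ?_, ?_⟩
      · intro z
        simp [h1, d1]
      · intro v w
        rw [LinearMap.add_apply, LinearMap.add_apply, hd, hd, h2, smul_add, Finset.smul_sum]
        simp only [G.e_smul_sum_eq d d2, G.apply_e_smul_eq d d3]
      · intro β hβ w
        have ht : (∑ v with G.rk v + n = N, d v) (G.a β • w) = 0 := by
          rw [hd]
          refine Finset.sum_eq_zero fun v hv => ?_
          rw [← G.e_t_mul, mul_smul, G.apply_e_smul_eq d d3, if_neg]
          rintro rfl
          have := G.rk_lt β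
          simp only [Finset.mem_filter] at hv
          omega
        have hs : G.a β • (∑ v with G.rk v + n = N, d v) w =
            if G.rk (G.s β) + n = N then G.a β • d (G.s β) w else 0 := by
          rw [hd, ← G.mul_e_s, mul_smul, Finset.smul_sum]
          simp only [G.e_smul_sum_eq d d2]
          rw [Finset.sum_ite_eq]
          simp only [Finset.mem_filter, Finset.mem_univ, true_and]
          split_ifs with h
          · rw [mul_smul, d2]
          · simp
        rw [LinearMap.add_apply, LinearMap.add_apply, ht, smul_add, hs, add_zero]
        split_ifs with hr
        · rw [d4 _ β rfl]
          abel
        · rw [add_zero, h3 β (by omega)]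
  obtain ⟨h, h1, h2, h3⟩ := key (N + 1)
  obtain ⟨h', hh'⟩ := G.exists_linearMap h h2 fun β w => h3 β (by omega) w
  exact ⟨h', fun z => by rw [hh', h1]⟩

theorem exists_lift [Fintype B] [Module k Z] [IsScalarTower k R Z] [Module k W]
    [IsScalarTower k R W] [Module k Y] [IsScalarTower k R Y] (f : W →ₗ[R] Z)
    (hf : Function.Surjective f) (g : Y →ₗ[R] Z)
    (H : ∀ v, (∀ w, f (G.e v • w) = 0 → G.e v • w = 0) ∨ G.InjAt Y v) :
    ∃ h : Y →ₗ[R] W, ∀ y, f (h y) = g y := by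
  obtain ⟨N, hN⟩ := G.exists_rk_le
  have key : ∀ n, ∃ h : Y →ₗ[k] W, (∀ y, f (h y) = g y) ∧
      (∀ v y, h (G.e v • y) = G.e v • h y) ∧
      ∀ β, G.rk (G.t β) < n → ∀ y, h (G.a β • y) = G.a β • h y := by
    intro n
    induction n with
    | zero =>
      obtain ⟨p, hp⟩ := (f.restrictScalars k).exists_rightInverse_of_surjective
        (LinearMap.range_eq_top.mpr hf)
      have hp' : ∀ z, f (p z) = z := fun z => LinearMap.congr_fun hp z
      refine ⟨G.diag (p ∘ₗ g.restrictScalars k), fun y => ?_, fun v w => G.diag_e_smul _ v w,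
        fun β hβ => absurd hβ (by omega)⟩
      rw [diag_apply, map_sum]
      conv_rhs => rw [← G.sum_e_smul (g y)]
      refine Finset.sum_congr rfl fun v _ => ?_
      rw [f.map_smul]
      simp [hp', g.map_smul, G.e_smul_e_smul]
    | succ n ih =>
      obtain ⟨h, h1, h2, h3⟩ := ih
      choose d d1 d2 d3 d4 using fun v => G.exists_lift_step f g v (H v) h h1 h2
      have hd : ∀ w, (∑ v with G.rk v = n, d v) w = ∑ v with G.rk v = n, d v w := by
        intro w
        simp
      refine ⟨h + ∑ v with G.rk v = n, d v, ?_, ?_, ?_⟩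
      · intro z
        simp [h1, d1]
      · intro v w
        rw [LinearMap.add_apply, LinearMap.add_apply, hd, hd, h2, smul_add, Finset.smul_sum]
        simp only [G.e_smul_sum_eq d d2, G.apply_e_smul_eq d d3]
      · intro β hβ w
        have hs : G.a β • (∑ v with G.rk v = n, d v) w = 0 := by
          rw [hd, Finset.smul_sum]
          refine Finset.sum_eq_zero fun v hv => ?_
          rw [← G.mul_e_s, mul_smul, G.e_smul_sum_eq d d2, if_neg, smul_zero]
          rintro rfl
          have := G.rk_lt β
          simp only [Finset.mem_filter] at hv
          omega
        have ht : (∑ v with G.rk v = n, d v) (G.a β • w) =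
            if G.rk (G.t β) = n then d (G.t β) (G.a β • w) else 0 := by
          rw [hd, ← G.e_t_mul, mul_smul]
          simp only [G.apply_e_smul_eq d d3]
          rw [Finset.sum_ite_eq]
          simp
        rw [LinearMap.add_apply, LinearMap.add_apply, ht, smul_add, hs, add_zero]
        split_ifs with hr
        · rw [d4 _ β rfl]
          abel
        · rw [add_zero, h3 β (by omega)]
  obtain ⟨h, h1, h2, h3⟩ := key (N + 1)
  obtain ⟨h', hh'⟩ := G.exists_linearMap h h2 fun β w => h3 β (Nat.lt_succ_of_le (hN _)) w
  exact ⟨h', fun z => by rw [hh', h1]⟩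

end Lifting

section

variable {Y : Type*} [AddCommGroup Y] [Module R Y] {v : V}

variable {G} in
lemma SurjAt.of_surjective {Y' : Type*} [AddCommGroup Y'] [Module R Y'] (hY : G.SurjAt Y v)
    (f : Y →ₗ[R] Y') (hf : Function.Surjective f) : G.SurjAt Y' v := by
  intro y
  choose y' hy' using fun β => hf (y β)
  obtain ⟨x, hx⟩ := hY y'
  exact ⟨f x, fun β hβ => by rw [← f.map_smul, hx β hβ, f.map_smul, hy']⟩

variable {G} in
lemma SurjAt.pi {ι : Type*} {Y : ι → Type*} [∀ i, AddCommGroup (Y i)] [∀ i, Module R (Y i)]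
    (hY : ∀ i, G.SurjAt (Y i) v) : G.SurjAt (∀ i, Y i) v := by
  intro y
  choose x hx using fun i => hY i fun β => y β i
  exact ⟨x, fun β hβ => funext fun i => hx i β hβ⟩

variable {G} in
lemma InjAt.of_injective [Fintype B] {Y' : Type*} [AddCommGroup Y'] [Module R Y']
    (hY : G.InjAt Y v) (f : Y' →ₗ[R] Y) (hf : Function.Injective f) : G.InjAt Y' v := by
  intro y hy β hβ
  apply hf
  rw [f.map_smul, f.map_zero]
  refine hY (fun β => f (y β)) ?_ β hβ
  simp only [← f.map_smul, ← map_sum, hy, f.map_zero]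

variable {G} in
lemma InjAt.pi [Fintype B] {ι : Type*} {Y : ι → Type*} [∀ i, AddCommGroup (Y i)]
    [∀ i, Module R (Y i)] (hY : ∀ i, G.InjAt (Y i) v) : G.InjAt (∀ i, Y i) v := by
  intro y hy β hβ
  refine funext fun i => hY i (fun β => y β i) ?_ β hβ
  have := congrFun hy i
  simpa using this

end

theorem injective_of_surjAt {Y : Type*} [AddCommGroup Y] [Module R Y]
    (hY : ∀ v, G.SurjAt Y v) : Module.Injective R Y := by
  refine ⟨fun Z W _ _ _ _ f hf g => ?_⟩
  let := Module.compHom Z (algebraMap k R)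
  let := Module.compHom W (algebraMap k R)
  let := Module.compHom Y (algebraMap k R)
  have : IsScalarTower k R Z := IsScalarTower.of_algebraMap_smul fun _ _ => rfl
  have : IsScalarTower k R W := IsScalarTower.of_algebraMap_smul fun _ _ => rfl
  have : IsScalarTower k R Y := IsScalarTower.of_algebraMap_smul fun _ _ => rfl
  exact G.exists_extension f hf g fun v => Or.inr (hY v)

theorem projective_of_injAt [Fintype B] {Y : Type*} [AddCommGroup Y] [Module R Y]
    (hY : ∀ v, G.InjAt Y v) : Module.Projective R Y := by
  refine Module.Projective.of_lifting_property'' fun f hf => ?_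
  let := Module.compHom Y (algebraMap k R)
  have : IsScalarTower k R Y := IsScalarTower.of_algebraMap_smul fun _ _ => rfl
  obtain ⟨h, hh⟩ := G.exists_lift f hf LinearMap.id fun v => Or.inr (hY v)
  exact ⟨h, LinearMap.ext hh⟩

end AcyclicGen

/-! ### The generators of a toupie algebra -/

section Generators

variable {k : Type u} [Field k] {t : ℕ} {ℓ : Fin t → ℕ}

lemma vtx_zero (i : Fin t) : vtx t ℓ i 0 = .src := by simp [vtx]

lemma vtx_of_le (i : Fin t) {a : ℕ} (h0 : a ≠ 0) (h : ℓ i ≤ a) : vtx t ℓ i a = .snk := by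
  rw [vtx, if_neg h0, dif_neg (by omega)]

lemma vtx_of_lt (i : Fin t) {a : ℕ} (h0 : a ≠ 0) (h : a < ℓ i) :
    vtx t ℓ i a = .mid i ⟨a - 1, by omega⟩ := by
  rw [vtx, if_neg h0, dif_pos]

lemma vtx_ne_snk (i : Fin t) {a : ℕ} (h : a < ℓ i) : vtx t ℓ i a ≠ .snk := by
  by_cases h0 : a = 0
  · subst h0
    simp [vtx_zero]
  · simp [vtx_of_lt i h0 h]

lemma vtx_ne_src (i : Fin t) {a : ℕ} (h0 : a ≠ 0) : vtx t ℓ i a ≠ .src := by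
  rw [vtx, if_neg h0]
  split_ifs <;> simp

lemma vtx_eq_iff {i j : Fin t} {a b : ℕ} (h0 : a ≠ 0) (h : a < ℓ i) :
    vtx t ℓ j b = vtx t ℓ i a ↔ j = i ∧ b = a := by
  constructor
  · intro hv
    rw [vtx_of_lt i h0 h, vtx] at hv
    split_ifs at hv with h1 h2
    obtain ⟨rfl, hv⟩ := Vtx.mid.inj hv
    simp at hv
    exact ⟨rfl, by omega⟩
  · rintro ⟨rfl, rfl⟩
    rfl

instance : Finite (Vtx t ℓ) := by
  refine Finite.of_injective (β := Option (Option (Σ i : Fin t, Fin (ℓ i - 1))))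
    (fun v => match v with
      | .src => none
      | .snk => some none
      | .mid i a => some (some ⟨i, a⟩)) ?_
  rintro (_ | _ | _) (_ | _ | _) <;> simp

instance : Fintype (Vtx t ℓ) := Fintype.ofFinite _

instance : Finite (PIdx t ℓ) := by
  refine Finite.of_injective (β := Vtx t ℓ ⊕ (Σ i : Fin t, Fin (ℓ i + 1) × Fin (ℓ i + 1)))
    (fun p => match p with
      | .vert v => .inl v
      | .sub i a b hab hb => .inr ⟨i, ⟨a, by omega⟩, ⟨b, by omega⟩⟩) ?_
  rintro (_ | ⟨i, a, b, _, _⟩) (_ | ⟨j, c, d, _, _⟩) h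
  · simpa using h
  · simp at h
  · simp at h
  · simp only [Sum.inr.injEq, Sigma.mk.injEq] at h
    obtain ⟨rfl, h⟩ := h
    simp at h
    obtain ⟨rfl, rfl⟩ := h
    rfl

lemma Ev_mul_Ev (v w : Vtx t ℓ) : Ev k v * Ev k w = if v = w then Ev k v else 0 := by
  refine LinearMap.ext fun f => funext fun p => ?_
  by_cases h : v = w
  · subst h
    simp +contextual [Ev, eq_comm]
  · simp only [if_neg h]
    simp only [Ev, Module.End.mul_apply, LinearMap.coe_mk, AddHom.coe_mk, LinearMap.zero_apply,
      Pi.zero_apply]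
    split_ifs with h1 h2
    · exact absurd (h1.symm.trans h2) h
    · rfl
    · rfl

lemma sum_Ev : ∑ v : Vtx t ℓ, Ev k v = 1 := by
  refine LinearMap.ext fun f => funext fun p => ?_
  simp [Ev, Finset.sum_apply]

lemma Ev_mul_Ar (i : Fin t) (j : ℕ) : Ev k (vtx t ℓ i j) * Ar k i j = Ar k i j := by
  refine LinearMap.ext fun f => funext fun p => ?_
  simp only [Ev, Ar, Module.End.mul_apply, LinearMap.coe_mk, AddHom.coe_mk]
  split_ifs with h
  · rfl
  · rcases p with v | ⟨i', a, b, hab, hb⟩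
    · rfl
    · rw [strip, dif_neg]
      · rfl
      · rintro ⟨rfl, rfl⟩
        exact h rfl

lemma Ar_mul_Ev (i : Fin t) (j : ℕ) : Ar k i j * Ev k (vtx t ℓ i (j + 1)) = Ar k i j := by
  refine LinearMap.ext fun f => funext fun p => ?_
  simp only [Ev, Ar, Module.End.mul_apply, LinearMap.coe_mk, AddHom.coe_mk]
  rcases h : strip i j p with _ | q
  · rfl
  · suffices startIdx q = vtx t ℓ i (j + 1) by simp [this]
    rcases p with v | ⟨i', a, b, hab, hb⟩
    · simp [strip] at h
    · rw [strip] at h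
      split_ifs at h with h1 h2
      · obtain rfl := Option.some.inj h
        rfl
      · obtain rfl := Option.some.inj h
        have : b = j + 1 := by omega
        subst this
        rfl

lemma Ar_eq_zero (i : Fin t) {j : ℕ} (hj : ℓ i ≤ j) : Ar k (ℓ := ℓ) i j = 0 := by
  ext f p
  have : strip i j p = none := by
    rcases p with v | ⟨i', a, b, hab, hb⟩
    · rfl
    · rw [strip, dif_neg]
      rintro ⟨rfl, rfl⟩
      omega
  simp [Ar, this]

end Generators

section Paths

variable {k : Type u} [Field k] (T : ToupieAlg k)

/-- The arrow `j` of branch `i` in the opposite of a toupie algebra. -/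
def arr (i : Fin T.t) (j : ℕ) : (Alg T)ᵐᵒᵖ := op (mkA T (arE i j))

lemma arr_eq_zero (i : Fin T.t) {j : ℕ} (hj : T.ℓ i ≤ j) : arr T i j = 0 := by
  have : arE (k := k) (ℓ := T.ℓ) i j = 0 := Subtype.ext (Ar_eq_zero i hj)
  rw [arr, this, map_zero, op_zero]

lemma actV_mul_arr (i : Fin T.t) (j : ℕ) :
    actV T (vtx T.t T.ℓ i (j + 1)) * arr T i j = arr T i j := by
  rw [arr, actV, ← op_mul, ← map_mul]
  exact congrArg (fun x => op (mkA T x)) (Subtype.ext (Ar_mul_Ev i j))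

lemma arr_mul_actV (i : Fin T.t) (j : ℕ) :
    arr T i j * actV T (vtx T.t T.ℓ i j) = arr T i j := by
  rw [arr, actV, ← op_mul, ← map_mul]
  exact congrArg (fun x => op (mkA T x)) (Subtype.ext (Ev_mul_Ar i j))

/-- The vertices and arrows of a toupie quiver generate the opposite of the toupie algebra, whose
left modules are the right modules of the paper. -/
def toupieGen : AcyclicGen k (Alg T)ᵐᵒᵖ (Vtx T.t T.ℓ) (Σ i : Fin T.t, Fin (T.ℓ i)) where
  e := actV T
  a β := arr T β.1 β.2
  s β := vtx T.t T.ℓ β.1 β.2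
  t β := vtx T.t T.ℓ β.1 (β.2 + 1)
  rk v := match v with
    | .src => 0
    | .mid _ a => a + 1
    | .snk => 1 + ∑ i, T.ℓ i
  rk_lt := by
    rintro ⟨i, a, ha⟩
    have hle : T.ℓ i ≤ ∑ i, T.ℓ i := Finset.single_le_sum (fun _ _ => Nat.zero_le _)
      (Finset.mem_univ i)
    simp only
    by_cases h0 : a = 0 <;> by_cases h1 : T.ℓ i ≤ a + 1
    · subst h0
      rw [vtx_zero, vtx_of_le i (by omega) h1]
      simp
    · subst h0
      rw [vtx_zero, vtx_of_lt i (by omega) (by omega)]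
      simp
    · rw [vtx_of_lt i h0 ha, vtx_of_le i (by omega) h1]
      simp only
      omega
    · rw [vtx_of_lt i h0 ha, vtx_of_lt i (by omega) (by omega)]
      simp only
      omega
  e_mul v w := by
    have : eV (k := k) (t := T.t) (ℓ := T.ℓ) w * eV v = if v = w then eV v else 0 := by
      apply Subtype.ext
      refine (Ev_mul_Ev w v).trans ?_
      by_cases h : v = w
      · subst h
        simp [eV]
      · simp [h, Ne.symm h]
    rw [actV, actV, ← op_mul, ← map_mul, this]
    split_ifs <;> simp
  e_sum := by
    have : ∑ v : Vtx T.t T.ℓ, eV (k := k) v = 1 := by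
      apply Subtype.ext
      rw [AddSubmonoidClass.coe_finsetSum]
      exact sum_Ev
    simp only [actV]
    rw [← Finset.op_sum, ← map_sum, this, map_one, op_one]
  e_t_mul β := actV_mul_arr T _ _
  mul_e_s β := arr_mul_actV T _ _
  induction P hc he ha hadd hmul r := by
    obtain ⟨⟨y, hy⟩, hyr⟩ := mkA_surjective T r.unop
    obtain rfl : op (mkA T ⟨y, hy⟩) = r := by rw [hyr, op_unop]
    clear hyr
    induction hy using Algebra.adjoin_induction with
    | mem x hx =>
      rcases hx with ⟨v, rfl⟩ | ⟨i, j, rfl⟩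
      · exact he v
      · by_cases hj : j < T.ℓ i
        · exact ha ⟨i, j, hj⟩
        · have h0 := hc 0
          rw [map_zero, ← arr_eq_zero T i (not_lt.mp hj)] at h0
          exact h0
    | algebraMap c => exact hc c
    | add x y hx hy ihx ihy => exact hadd _ _ ihx ihy
    | mul x y hx hy ihx ihy => exact hmul _ _ ihy ihx

/-- The path of length `n` starting at the `a`-th vertex of branch `i`, in the opposite of a
toupie algebra. -/
def seg (i : Fin T.t) (a : ℕ) : ℕ → (Alg T)ᵐᵒᵖ
  | 0 => actV T (vtx T.t T.ℓ i a)
  | n + 1 => arr T i (a + n) * seg i a n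

lemma actV_mul_self (v : Vtx T.t T.ℓ) : actV T v * actV T v = actV T v :=
  ((toupieGen T).e_mul v v).trans (if_pos rfl)

lemma actV_mul_seg (i : Fin T.t) (a n : ℕ) :
    actV T (vtx T.t T.ℓ i (a + n)) * seg T i a n = seg T i a n := by
  cases n with
  | zero => exact actV_mul_self T _
  | succ n => rw [seg, ← mul_assoc, ← add_assoc, actV_mul_arr]

lemma seg_mul_actV (i : Fin T.t) (a n : ℕ) :
    seg T i a n * actV T (vtx T.t T.ℓ i a) = seg T i a n := by
  induction n with
  | zero => exact actV_mul_self T _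
  | succ n ih => rw [seg, mul_assoc, ih]

lemma seg_succ' (i : Fin T.t) (a n : ℕ) :
    seg T i a (n + 1) = seg T i (a + 1) n * arr T i a := by
  induction n with
  | zero => rw [seg, seg, seg, actV_mul_arr, add_zero, arr_mul_actV]
  | succ n ih => rw [seg, ih, seg, ← mul_assoc, add_assoc, add_comm 1 n]

lemma seg_eq_zero_of_lt (i : Fin T.t) {a n : ℕ} (hn : n ≠ 0) (h : T.ℓ i < a + n) :
    seg T i a n = 0 := by
  obtain ⟨n, rfl⟩ := Nat.exists_eq_succ_of_ne_zero hn
  rw [seg, arr_eq_zero T i (by omega), zero_mul]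

lemma seg_zero_eq_op (i : Fin T.t) (n : ℕ) :
    seg T i 0 n = op (mkA T (eV .src * subE i 0 n)) := by
  induction n with
  | zero => simp [seg, subE, vtx_zero, actV]
  | succ n ih =>
    rw [seg, ih, arr, ← op_mul, ← map_mul]
    simp [subE, List.range_succ, mul_assoc]

instance : Module.Finite k (Alg T) := by
  have : Module.Finite k (PathAlg k T.t T.ℓ) :=
    inferInstanceAs (Module.Finite k (Subalgebra.toSubmodule (PathAlg k T.t T.ℓ)))
  let f : PathAlg k T.t T.ℓ →ₗ[k] Alg T :=
    { toFun := mkA T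
      map_add' := map_add _
      map_smul' := fun c x => by
        rw [Algebra.smul_def, map_mul, RingHom.id_apply, Algebra.smul_def]
        rfl }
  exact Module.Finite.of_surjective f (mkA_surjective T)

lemma seg_branch_eq_zero (hm : mDim T = 0) (i : Fin T.t) : seg T i 0 (T.ℓ i) = 0 := by
  have hi := T.hℓ i
  have hbot : LinearMap.range (lrMap T) = ⊥ := Submodule.finrank_eq_zero.mp hm
  have h : lrMap T (mkA T (wE i)) ∈ LinearMap.range (lrMap T) := LinearMap.mem_range_self _ _
  rw [hbot, Submodule.mem_bot] at h
  rw [← actV_mul_seg, zero_add, vtx_of_le i (by omega) le_rfl, seg_zero_eq_op, actV, ← op_mul,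
    map_mul]
  exact congrArg op h

end Paths

section Modules

variable {k : Type u} [Field k] {T : ToupieAlg k}

section Smul

variable {X : Type*} [AddCommGroup X] [Module (Alg T)ᵐᵒᵖ X]

lemma actV_smul_actV_of_ne {v w : Vtx T.t T.ℓ} (h : v ≠ w) (x : X) :
    actV T v • actV T w • x = 0 :=
  ((toupieGen T).e_smul_e_smul v w x).trans (if_neg h)

lemma actV_smul_actV (v : Vtx T.t T.ℓ) (x : X) : actV T v • actV T v • x = actV T v • x := by
  rw [← mul_smul, actV_mul_self]

lemma actV_smul_arr (i : Fin T.t) (a : ℕ) (x : X) :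
    actV T (vtx T.t T.ℓ i (a + 1)) • arr T i a • x = arr T i a • x := by
  rw [← mul_smul, actV_mul_arr]

lemma arr_smul_actV (i : Fin T.t) (a : ℕ) (x : X) :
    arr T i a • actV T (vtx T.t T.ℓ i a) • x = arr T i a • x := by
  rw [← mul_smul, arr_mul_actV]

lemma actV_smul_seg (i : Fin T.t) (a n : ℕ) (x : X) :
    actV T (vtx T.t T.ℓ i (a + n)) • seg T i a n • x = seg T i a n • x := by
  rw [← mul_smul, actV_mul_seg]

lemma seg_smul_actV (i : Fin T.t) (a n : ℕ) (x : X) :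
    seg T i a n • actV T (vtx T.t T.ℓ i a) • x = seg T i a n • x := by
  rw [← mul_smul, seg_mul_actV]

lemma actV_smul_arr_of_ne {v : Vtx T.t T.ℓ} {i : Fin T.t} {a : ℕ}
    (h : v ≠ vtx T.t T.ℓ i (a + 1)) (x : X) : actV T v • arr T i a • x = 0 := by
  rw [← actV_smul_arr, actV_smul_actV_of_ne h]

lemma actV_smul_seg_of_ne {v : Vtx T.t T.ℓ} {i : Fin T.t} {a n : ℕ}
    (h : v ≠ vtx T.t T.ℓ i (a + n)) (x : X) : actV T v • seg T i a n • x = 0 := by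
  rw [← actV_smul_seg, actV_smul_actV_of_ne h]

lemma arr_smul_actV_of_ne {v : Vtx T.t T.ℓ} {i : Fin T.t} {a : ℕ} (h : vtx T.t T.ℓ i a ≠ v)
    (x : X) : arr T i a • actV T v • x = 0 := by
  rw [← arr_smul_actV, actV_smul_actV_of_ne h, smul_zero]

lemma seg_smul_actV_of_ne {v : Vtx T.t T.ℓ} {i : Fin T.t} {a n : ℕ} (h : vtx T.t T.ℓ i a ≠ v)
    (x : X) : seg T i a n • actV T v • x = 0 := by
  rw [← seg_smul_actV, actV_smul_actV_of_ne h, smul_zero]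

lemma arr_smul_seg (i : Fin T.t) (a n : ℕ) (x : X) :
    arr T i (a + n) • seg T i a n • x = seg T i a (n + 1) • x := by
  rw [← mul_smul, seg]

lemma seg_smul_arr (i : Fin T.t) (a n : ℕ) (x : X) :
    seg T i (a + 1) n • arr T i a • x = seg T i a (n + 1) • x := by
  rw [← mul_smul, seg_succ']

lemma seg_smul_arr_of_ne {i j : Fin T.t} {a b n : ℕ} (h : vtx T.t T.ℓ i a ≠ vtx T.t T.ℓ j (b + 1))
    (x : X) : seg T i a n • arr T j b • x = 0 := by
  rw [← actV_smul_arr, seg_smul_actV_of_ne h]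

lemma smul_eq_zero_of_actV (r : (Alg T)ᵐᵒᵖ) {v : Vtx T.t T.ℓ} (hr : r * actV T v = r) {x : X}
    (h : actV T v • x = 0) : r • x = 0 := by
  rw [← hr, mul_smul, h, smul_zero]

lemma exists_branch (T : ToupieAlg k) : Nonempty (Fin T.t) :=
  ⟨⟨0, by have := T.ht; omega⟩⟩

lemma eq_zero_of_actV {x : X}
    (h : ∀ i, ∀ a < T.ℓ i, actV T (vtx T.t T.ℓ i a) • x = 0) (hs : actV T .snk • x = 0) :
    x = 0 := by
  rw [← (toupieGen T).sum_e_smul x]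
  refine Finset.sum_eq_zero fun v _ => ?_
  change actV T v • x = 0
  obtain ⟨i₀⟩ := exists_branch T
  rcases v with _ | _ | ⟨i, a, ha⟩
  · rw [← vtx_zero i₀]
    exact h i₀ 0 (T.hℓ i₀)
  · exact hs
  · have := h i (a + 1) (by omega)
    rwa [vtx_of_lt i (by omega) (by omega)] at this

end Smul

/-! ### Modules generated at the source -/

/-- The submodule generated by the space at the source. -/
def srcSpan (T : ToupieAlg k) (X : Type*) [AddCommGroup X] [Module (Alg T)ᵐᵒᵖ X] :
    Submodule (Alg T)ᵐᵒᵖ X :=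
  Submodule.span _ (Set.range fun x : X => actV T .src • x)

/-- A consequence of being generated by the space at the source. -/
def SrcGen (T : ToupieAlg k) (X : Type*) [AddCommGroup X] [Module (Alg T)ᵐᵒᵖ X] : Prop :=
  ∀ y : X, (∀ i, ∀ a < T.ℓ i, ∃ x : X, actV T (vtx T.t T.ℓ i a) • y = seg T i 0 a • x) ∧
    actV T .snk • y = 0

section SrcGen

variable {X : Type u} [AddCommGroup X] [Module (Alg T)ᵐᵒᵖ X]

lemma actV_src_mem_srcSpan (x : X) : actV T .src • x ∈ srcSpan T X :=
  Submodule.subset_span ⟨x, rfl⟩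

lemma srcGen_srcSpan [Module k X] [IsScalarTower k (Alg T)ᵐᵒᵖ X]
    (hz : ∀ i, seg T i 0 (T.ℓ i) = 0) : SrcGen T (srcSpan T X) := by
  let S : Submodule (Alg T)ᵐᵒᵖ X := (toupieGen T).submoduleOf
    (fun y => (∀ i, ∀ a < T.ℓ i, ∃ x ∈ srcSpan T X,
      actV T (vtx T.t T.ℓ i a) • y = seg T i 0 a • x) ∧ actV T .snk • y = 0)
    ⟨fun i a _ => ⟨0, zero_mem _, by simp⟩, smul_zero _⟩
    (by
      rintro x y ⟨hx, hx'⟩ ⟨hy, hy'⟩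
      refine ⟨fun i a ha => ?_, by rw [smul_add, hx', hy', add_zero]⟩
      obtain ⟨x', hm, hx⟩ := hx i a ha
      obtain ⟨y', hm', hy⟩ := hy i a ha
      exact ⟨x' + y', add_mem hm hm', by rw [smul_add, smul_add, hx, hy]⟩)
    (by
      rintro c x ⟨hx, hx'⟩
      refine ⟨fun i a ha => ?_, by rw [smul_algebra_smul_comm, hx', smul_zero]⟩
      obtain ⟨x', hm, hx⟩ := hx i a ha
      refine ⟨algebraMap k (Alg T)ᵐᵒᵖ c • x', Submodule.smul_mem _ _ hm, ?_⟩
      rw [algebraMap_smul, smul_algebra_smul_comm, hx, smul_algebra_smul_comm])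
    (by
      rintro v x ⟨hx, hx'⟩
      refine ⟨fun i a ha => ?_, ?_⟩
      · by_cases h : vtx T.t T.ℓ i a = v
        · obtain ⟨x', hm, hx⟩ := hx i a ha
          refine ⟨x', hm, ?_⟩
          subst h
          exact (actV_smul_actV _ _).trans hx
        · exact ⟨0, zero_mem _, (actV_smul_actV_of_ne h x).trans (smul_zero _).symm⟩
      · by_cases h : Vtx.snk = v
        · subst h
          exact (actV_smul_actV _ _).trans hx'
        · exact actV_smul_actV_of_ne h x)
    (by
      rintro ⟨j, b, hb⟩ y ⟨hy, hy'⟩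
      change (∀ i, ∀ a < T.ℓ i, ∃ x ∈ srcSpan T X,
        actV T (vtx T.t T.ℓ i a) • arr T j b • y = seg T i 0 a • x) ∧
        actV T .snk • arr T j b • y = 0
      obtain ⟨x', hm, hx⟩ := hy j b hb
      have hseg : arr T j b • y = seg T j 0 (b + 1) • x' := by
        rw [← arr_smul_actV, hx, ← arr_smul_seg, zero_add]
      refine ⟨fun i a ha => ?_, ?_⟩
      · by_cases h : vtx T.t T.ℓ i a = vtx T.t T.ℓ j (b + 1)
        · have h0 : a ≠ 0 := by
            rintro rfl
            rw [vtx_zero] at h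
            exact vtx_ne_src j (by omega) h.symm
          obtain ⟨rfl, rfl⟩ := (vtx_eq_iff h0 ha).mp h.symm
          exact ⟨x', hm, by rw [actV_smul_arr, hseg]⟩
        · exact ⟨0, zero_mem _, by rw [actV_smul_arr_of_ne h, smul_zero]⟩
      · by_cases h : Vtx.snk = vtx T.t T.ℓ j (b + 1)
        · have : b + 1 = T.ℓ j := by
            by_contra h'
            exact vtx_ne_snk j (by omega) h.symm
          rw [h, actV_smul_arr, hseg, this, hz, zero_smul]
        · exact actV_smul_arr_of_ne h _)
  have hS : srcSpan T X ≤ S := by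
    refine Submodule.span_le.mpr ?_
    rintro _ ⟨x, rfl⟩
    refine ⟨fun i a ha => ?_, actV_smul_actV_of_ne (by simp) _⟩
    by_cases h0 : a = 0
    · subst h0
      refine ⟨actV T .src • x, actV_src_mem_srcSpan x, ?_⟩
      rw [seg]
    · exact ⟨0, zero_mem _, by rw [actV_smul_actV_of_ne (vtx_ne_src i h0), smul_zero]⟩
  rintro ⟨y, hy⟩
  obtain ⟨h1, h2⟩ := hS hy
  refine ⟨fun i a ha => ?_, Subtype.ext h2⟩
  obtain ⟨x, hm, hx⟩ := h1 i a ha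
  exact ⟨⟨x, hm⟩, Subtype.ext hx⟩

lemma SrcGen.of_surjective (hX : SrcGen T X) {Y : Type*} [AddCommGroup Y] [Module (Alg T)ᵐᵒᵖ Y]
    (f : X →ₗ[(Alg T)ᵐᵒᵖ] Y) (hf : Function.Surjective f) : SrcGen T Y := by
  intro y
  obtain ⟨x, rfl⟩ := hf y
  obtain ⟨h1, h2⟩ := hX x
  refine ⟨fun i a ha => ?_, by rw [← f.map_smul, h2, f.map_zero]⟩
  obtain ⟨x', hx'⟩ := h1 i a ha
  exact ⟨f x', by rw [← f.map_smul, hx', f.map_smul]⟩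

lemma SrcGen.exists_arr_smul (hX : SrcGen T X) (i : Fin T.t) {a : ℕ} (ha : a < T.ℓ i) (y : X) :
    ∃ x : X, arr T i a • x = actV T (vtx T.t T.ℓ i (a + 1)) • y := by
  by_cases h : a + 1 < T.ℓ i
  · obtain ⟨x, hx⟩ := (hX y).1 i (a + 1) h
    refine ⟨seg T i 0 a • x, ?_⟩
    rw [hx, ← arr_smul_seg, zero_add]
  · refine ⟨0, ?_⟩
    rw [smul_zero, vtx_of_le i (by omega) (by omega), (hX y).2]

lemma SrcGen.surjAt (hX : SrcGen T X) {v : Vtx T.t T.ℓ}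
    (h : ∀ β, (toupieGen T).s β = v → (∀ y : X, (toupieGen T).e ((toupieGen T).t β) • y = 0) ∨
      ∀ β', β' ≠ β → (toupieGen T).s β' = v →
        ∀ y : X, (toupieGen T).e ((toupieGen T).t β') • y = 0) :
    (toupieGen T).SurjAt X v := by
  intro y
  have hzero : ∀ β, (∀ y : X, (toupieGen T).e ((toupieGen T).t β) • y = 0) →
      ∀ x : X, (toupieGen T).a β • x = 0 := fun β hβ x => by
    rw [← (toupieGen T).e_t_mul, mul_smul, hβ]
  by_cases hall : ∀ β, (toupieGen T).s β = v →
      ∀ y : X, (toupieGen T).e ((toupieGen T).t β) • y = 0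
  · exact ⟨0, fun β hβ => by rw [smul_zero, hall β hβ]⟩
  · push Not at hall
    obtain ⟨β, hβ, y', hy'⟩ := hall
    obtain ⟨x, hx⟩ := hX.exists_arr_smul β.1 β.2.2 (y β)
    refine ⟨x, fun β' hβ' => ?_⟩
    by_cases hne : β' = β
    · subst hne
      exact hx
    · rcases h β hβ with h | h
      · exact absurd (h y') hy'
      · rw [h β' hne hβ', hzero β' (h β' hne hβ')]

lemma SrcGen.surjAt_of_ne_src (hX : SrcGen T X) {v : Vtx T.t T.ℓ} (hv : v ≠ .src) :
    (toupieGen T).SurjAt X v := by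
  refine hX.surjAt ?_
  rintro ⟨i, a, ha⟩ rfl
  refine Or.inr ?_
  rintro ⟨j, b, hb⟩ hne h
  exfalso
  have h0 : a ≠ 0 := by
    rintro rfl
    exact hv (vtx_zero i)
  obtain ⟨rfl, rfl⟩ := (vtx_eq_iff h0 ha).mp h
  exact hne rfl

lemma SrcGen.surjAt_of_supported (hX : SrcGen T X) (i : Fin T.t)
    (hi : ∀ j, j ≠ i → ∀ b, b ≠ 0 → ∀ x : X, actV T (vtx T.t T.ℓ j b) • x = 0)
    (v : Vtx T.t T.ℓ) : (toupieGen T).SurjAt X v := by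
  by_cases hv : v = .src
  · refine hX.surjAt ?_
    rintro ⟨j, b, hb⟩ hβ
    by_cases hj : j = i
    · subst hj
      refine Or.inr ?_
      rintro ⟨j', b', hb'⟩ hne h
      refine hi j' ?_ (b' + 1) (by omega)
      rintro rfl
      have h0 : b = 0 := by
        by_contra h0
        exact vtx_ne_src j' h0 (hβ.trans hv)
      have h0' : b' = 0 := by
        by_contra h0'
        exact vtx_ne_src j' h0' (h.trans hv)
      subst h0 h0'
      exact hne rfl
    · exact Or.inl (hi j hj (b + 1) (by omega))
  · exact hX.surjAt_of_ne_src hv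

/-- The elements vanishing at the vertices of branch `i` other than the sink. -/
def offBranch (T : ToupieAlg k) (X : Type*) [AddCommGroup X] [Module (Alg T)ᵐᵒᵖ X] [Module k X]
    [IsScalarTower k (Alg T)ᵐᵒᵖ X] (i : Fin T.t) : Submodule (Alg T)ᵐᵒᵖ X :=
  (toupieGen T).submoduleOf (fun x => ∀ a < T.ℓ i, actV T (vtx T.t T.ℓ i a) • x = 0)
    (fun _ _ => smul_zero _)
    (fun x y hx hy a ha => by rw [smul_add, hx a ha, hy a ha, add_zero])
    (fun c x hx a ha => by rw [smul_algebra_smul_comm, hx a ha, smul_zero])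
    (fun v x hx a ha => by
      by_cases h : vtx T.t T.ℓ i a = v
      · subst h
        exact (actV_smul_actV _ _).trans (hx a ha)
      · exact actV_smul_actV_of_ne h x)
    (by
      rintro ⟨j, b, hb⟩ x hx a ha
      change actV T (vtx T.t T.ℓ i a) • arr T j b • x = 0
      by_cases h : vtx T.t T.ℓ i a = vtx T.t T.ℓ j (b + 1)
      · have h0 : a ≠ 0 := by
          rintro rfl
          rw [vtx_zero] at h
          exact vtx_ne_src j (by omega) h.symm
        obtain ⟨rfl, rfl⟩ := (vtx_eq_iff h0 ha).mp h.symm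
        rw [actV_smul_arr, ← arr_smul_actV, hx b hb, smul_zero]
      · exact actV_smul_arr_of_ne h x)

lemma SrcGen.idLeOne {X : ModuleCat.{u} (Alg T)ᵐᵒᵖ} (hX : SrcGen T X) :
    IdLeOne (Alg T)ᵐᵒᵖ X := by
  let := Module.compHom X (algebraMap k (Alg T)ᵐᵒᵖ)
  have : IsScalarTower k (Alg T)ᵐᵒᵖ X := IsScalarTower.of_algebraMap_smul fun _ _ => rfl
  have hS : ∀ v, (toupieGen T).SurjAt (∀ i, X ⧸ offBranch T X i) v := fun v =>
    AcyclicGen.SurjAt.pi fun i => by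
      refine (hX.of_surjective _ (Submodule.mkQ_surjective (offBranch T X i))).surjAt_of_supported i
        (fun j hj b hb x => ?_) v
      obtain ⟨x, rfl⟩ := Submodule.mkQ_surjective _ x
      rw [← map_smul, Submodule.mkQ_apply, Submodule.Quotient.mk_eq_zero]
      intro a ha
      refine actV_smul_actV_of_ne (fun h => ?_) x
      by_cases h0 : a = 0
      · subst h0
        rw [vtx_zero] at h
        exact vtx_ne_src j hb h.symm
      · exact hj ((vtx_eq_iff h0 ha).mp h.symm).1
  refine ⟨ModuleCat.of _ (∀ i, X ⧸ offBranch T X i),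
    LinearMap.pi fun i => (offBranch T X i).mkQ, ?_, ?_, ?_⟩
  · refine (injective_iff_map_eq_zero _).mpr fun x hx => ?_
    refine eq_zero_of_actV (fun i a ha => ?_) (hX x).2
    have := congrFun hx i
    rw [LinearMap.pi_apply, Submodule.mkQ_apply, Pi.zero_apply,
      Submodule.Quotient.mk_eq_zero] at this
    exact this a ha
  · exact (toupieGen T).injective_of_surjAt hS
  · exact (toupieGen T).injective_of_surjAt fun v =>
      (hS v).of_surjective _ (Submodule.mkQ_surjective _)

lemma srcGen_of_indec {X : ModuleCat.{u} (Alg T)ᵐᵒᵖ} (hz : ∀ i, seg T i 0 (T.ℓ i) = 0)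
    (hX : Indec (Alg T)ᵐᵒᵖ X) {x : X} (hx : actV T .src • x ≠ 0) : SrcGen T X := by
  let := Module.compHom X (algebraMap k (Alg T)ᵐᵒᵖ)
  have : IsScalarTower k (Alg T)ᵐᵒᵖ X := IsScalarTower.of_algebraMap_smul fun _ _ => rfl
  have hN := srcGen_srcSpan (X := X) hz
  obtain ⟨h, hh⟩ := (toupieGen T).exists_extension (srcSpan T X).subtype
    Subtype.val_injective LinearMap.id fun v => by
      by_cases hv : v = .src
      · exact Or.inl fun w => ⟨⟨actV T .src • w, actV_src_mem_srcSpan w⟩, by rw [hv]; rfl⟩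
      · exact Or.inr (hN.surjAt_of_ne_src hv)
  have hidem := hX.2 ((srcSpan T X).subtype.comp h)
    (LinearMap.ext fun y => congrArg Subtype.val (hh (h y)))
  rcases hidem with h0 | h1
  · refine absurd ?_ hx
    have := LinearMap.congr_fun h0 (actV T .src • x)
    have h2 := hh ⟨_, actV_src_mem_srcSpan x⟩
    exact (congrArg Subtype.val h2).symm.trans this
  · exact hN.of_surjective (srcSpan T X).subtype fun y => ⟨h y, LinearMap.congr_fun h1 y⟩

end SrcGen

/-! ### Modules cogenerated at the sink -/

/-- The vanishing on `x` of the paths ending at the sink. -/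
def KilledToSnk (T : ToupieAlg k) {X : Type*} [AddCommGroup X] [Module (Alg T)ᵐᵒᵖ X] (x : X) :
    Prop :=
  ∀ i, ∀ a ≤ T.ℓ i, seg T i a (T.ℓ i - a) • x = 0

/-- A module no nonzero element of which is killed by all paths ending at the sink. -/
def SnkCogen (T : ToupieAlg k) (X : Type*) [AddCommGroup X] [Module (Alg T)ᵐᵒᵖ X] : Prop :=
  ∀ x : X, KilledToSnk T x → x = 0

section SnkCogen

variable {X : Type u} [AddCommGroup X] [Module (Alg T)ᵐᵒᵖ X]

lemma KilledToSnk.actV_snk {x : X} (hx : KilledToSnk T x) : actV T .snk • x = 0 := by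
  obtain ⟨i⟩ := exists_branch T
  have h := hx i (T.ℓ i) le_rfl
  have := T.hℓ i
  rwa [Nat.sub_self, seg, vtx_of_le i (by omega) le_rfl] at h

/-- The submodule of the elements killed by all paths ending at the sink. -/
def snkKer (T : ToupieAlg k) (X : Type*) [AddCommGroup X] [Module (Alg T)ᵐᵒᵖ X] [Module k X]
    [IsScalarTower k (Alg T)ᵐᵒᵖ X] : Submodule (Alg T)ᵐᵒᵖ X :=
  (toupieGen T).submoduleOf (KilledToSnk T)
    (fun _ _ _ => smul_zero _)
    (fun x y hx hy i a ha => by rw [smul_add, hx i a ha, hy i a ha, add_zero])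
    (fun c x hx i a ha => by rw [smul_algebra_smul_comm, hx i a ha, smul_zero])
    (fun v x hx i a ha => by
      by_cases h : vtx T.t T.ℓ i a = v
      · subst h
        exact (seg_smul_actV _ _ _ _).trans (hx i a ha)
      · exact seg_smul_actV_of_ne h x)
    (by
      rintro ⟨j, b, hb⟩ x hx i a ha
      change seg T i a (T.ℓ i - a) • arr T j b • x = 0
      by_cases h : vtx T.t T.ℓ i a = vtx T.t T.ℓ j (b + 1)
      · by_cases ha' : a = T.ℓ i
        · have hi := T.hℓ i
          rw [vtx_of_le i (by omega) (by omega)] at h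
          have hb' : b + 1 = T.ℓ j := by
            by_contra h'
            exact vtx_ne_snk j (by omega) h.symm
          have hx' := hx j b (by omega)
          rw [← hb', Nat.add_sub_cancel_left, seg, seg, mul_smul, add_zero, arr_smul_actV] at hx'
          rw [hx', smul_zero]
        · have h0 : a ≠ 0 := by
            rintro rfl
            rw [vtx_zero] at h
            exact vtx_ne_src j (by omega) h.symm
          obtain ⟨rfl, rfl⟩ := (vtx_eq_iff h0 (by omega)).mp h.symm
          rw [seg_smul_arr, show T.ℓ j - (b + 1) + 1 = T.ℓ j - b by omega]
          exact hx j b (by omega)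
      · exact seg_smul_arr_of_ne h x)

lemma snkCogen_quotient [Module k X] [IsScalarTower k (Alg T)ᵐᵒᵖ X] :
    SnkCogen T (X ⧸ snkKer T X) := by
  intro y hy
  obtain ⟨x, rfl⟩ := Submodule.mkQ_surjective _ y
  rw [Submodule.mkQ_apply, Submodule.Quotient.mk_eq_zero]
  intro i a ha
  have h := hy i a ha
  rw [← map_smul, Submodule.mkQ_apply, Submodule.Quotient.mk_eq_zero] at h
  have hi := T.hℓ i
  have h' := h.actV_snk
  rwa [← vtx_of_le i (a := a + (T.ℓ i - a)) (by omega) (by omega), actV_smul_seg] at h'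

lemma SnkCogen.of_injective (hX : SnkCogen T X) {Y : Type*} [AddCommGroup Y]
    [Module (Alg T)ᵐᵒᵖ Y] (f : Y →ₗ[(Alg T)ᵐᵒᵖ] X) (hf : Function.Injective f) :
    SnkCogen T Y := fun y hy =>
  hf ((hX (f y) fun i a ha => by rw [← f.map_smul, hy i a ha, f.map_zero]).trans f.map_zero.symm)

lemma SnkCogen.actV_src (hX : SnkCogen T X) (hz : ∀ i, seg T i 0 (T.ℓ i) = 0) (x : X) :
    actV T .src • x = 0 := by
  refine hX _ fun i a _ => ?_
  by_cases h0 : a = 0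
  · subst h0
    rw [Nat.sub_zero, hz, zero_smul]
  · exact seg_smul_actV_of_ne (vtx_ne_src i h0) x

lemma SnkCogen.actV_smul_eq_zero (hX : SnkCogen T X) (hz : ∀ i, seg T i 0 (T.ℓ i) = 0)
    (i : Fin T.t) {a : ℕ} (ha : a < T.ℓ i) {x : X} (hx : arr T i a • x = 0) :
    actV T (vtx T.t T.ℓ i a) • x = 0 := by
  by_cases h0 : a = 0
  · rw [h0, vtx_zero, hX.actV_src hz]
  refine hX _ fun j b hb => ?_
  by_cases h : vtx T.t T.ℓ j b = vtx T.t T.ℓ i a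
  · obtain ⟨rfl, rfl⟩ := (vtx_eq_iff h0 ha).mp h
    rw [seg_smul_actV, show T.ℓ j - b = T.ℓ j - b - 1 + 1 by omega, ← seg_smul_arr, hx, smul_zero]
  · exact seg_smul_actV_of_ne h x

lemma SnkCogen.injAt (hX : SnkCogen T X) (hz : ∀ i, seg T i 0 (T.ℓ i) = 0) {v : Vtx T.t T.ℓ}
    (h : ∀ β, (toupieGen T).t β = v → (∀ y : X, (toupieGen T).e ((toupieGen T).s β) • y = 0) ∨
      ∀ β', β' ≠ β → (toupieGen T).t β' = v → ∀ y : X, (toupieGen T).a β' • y = 0) :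
    (toupieGen T).InjAt X v := by
  intro y hy β hβ
  rcases h β hβ with h | h
  · exact h _
  · refine hX.actV_smul_eq_zero hz β.1 β.2.2 ?_
    rw [Finset.sum_eq_single_of_mem β (by simpa using hβ)
      fun β' hβ' hne => h β' hne (by simpa using hβ') _] at hy
    exact hy

lemma SnkCogen.injAt_of_ne_snk (hX : SnkCogen T X) (hz : ∀ i, seg T i 0 (T.ℓ i) = 0)
    {v : Vtx T.t T.ℓ} (hv : v ≠ .snk) : (toupieGen T).InjAt X v := by
  refine hX.injAt hz ?_
  rintro ⟨i, a, ha⟩ rfl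
  refine Or.inr ?_
  rintro ⟨j, b, hb⟩ hne h
  exfalso
  have hlt : a + 1 < T.ℓ i := by
    by_contra hle
    exact hv (vtx_of_le i (a := a + 1) (by omega) (by omega))
  obtain ⟨rfl, hab⟩ := (vtx_eq_iff (j := j) (b := b + 1) (by omega) hlt).mp h
  obtain rfl : b = a := by omega
  exact hne rfl

lemma SnkCogen.injAt_of_supported (hX : SnkCogen T X) (hz : ∀ i, seg T i 0 (T.ℓ i) = 0)
    (i : Fin T.t)
    (hi : ∀ j, j ≠ i → ∀ b < T.ℓ j, ∀ x : X, actV T (vtx T.t T.ℓ j b) • x = 0)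
    (v : Vtx T.t T.ℓ) : (toupieGen T).InjAt X v := by
  by_cases hv : v = .snk
  · refine hX.injAt hz ?_
    rintro ⟨j, b, hb⟩ hβ
    by_cases hj : j = i
    · subst hj
      refine Or.inr ?_
      rintro ⟨j', b', hb'⟩ hne h y
      have hj' : j' ≠ j := by
        rintro rfl
        have h1 : b + 1 = T.ℓ j' := by
          by_contra h'
          exact vtx_ne_snk j' (a := b + 1) (by omega) (hβ.trans hv)
        have h2 : b' + 1 = T.ℓ j' := by
          by_contra h'
          exact vtx_ne_snk j' (a := b' + 1) (by omega) (h.trans hv)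
        obtain rfl : b' = b := by omega
        exact hne rfl
      exact smul_eq_zero_of_actV _ (arr_mul_actV T j' b') (hi j' hj' b' hb' y)
    · exact Or.inl (hi j hj b hb)
  · exact hX.injAt_of_ne_snk hz hv

/-- The elements vanishing at the vertices other than the sink of all branches but `i`. -/
def onBranch (T : ToupieAlg k) (X : Type*) [AddCommGroup X] [Module (Alg T)ᵐᵒᵖ X] [Module k X]
    [IsScalarTower k (Alg T)ᵐᵒᵖ X] (hsrc : ∀ x : X, actV T .src • x = 0) (i : Fin T.t) :
    Submodule (Alg T)ᵐᵒᵖ X :=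
  (toupieGen T).submoduleOf
    (fun x => ∀ j, j ≠ i → ∀ a < T.ℓ j, actV T (vtx T.t T.ℓ j a) • x = 0)
    (fun _ _ _ _ => smul_zero _)
    (fun x y hx hy j hj a ha => by rw [smul_add, hx j hj a ha, hy j hj a ha, add_zero])
    (fun c x hx j hj a ha => by rw [smul_algebra_smul_comm, hx j hj a ha, smul_zero])
    (fun v x hx j hj a ha => by
      by_cases h : vtx T.t T.ℓ j a = v
      · subst h
        exact (actV_smul_actV _ _).trans (hx j hj a ha)
      · exact actV_smul_actV_of_ne h x)
    (by
      rintro ⟨j', b, hb⟩ x hx j hj a ha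
      change actV T (vtx T.t T.ℓ j a) • arr T j' b • x = 0
      by_cases h : vtx T.t T.ℓ j a = vtx T.t T.ℓ j' (b + 1)
      · by_cases h0 : a = 0
        · rw [h0, vtx_zero, hsrc]
        obtain ⟨rfl, rfl⟩ := (vtx_eq_iff h0 ha).mp h.symm
        rw [actV_smul_arr, ← arr_smul_actV, hx j' hj b hb, smul_zero]
      · exact actV_smul_arr_of_ne h x)

lemma exists_sum_onBranch [Module k X] [IsScalarTower k (Alg T)ᵐᵒᵖ X]
    (hsrc : ∀ x : X, actV T .src • x = 0) (x : X) :
    ∃ y : ∀ i, onBranch T X hsrc i, ∑ i, (y i : X) = x := by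
  obtain ⟨i₀⟩ := exists_branch T
  let b : Vtx T.t T.ℓ → Fin T.t := fun v => match v with
    | .src => i₀
    | .snk => i₀
    | .mid i _ => i
  refine ⟨fun i => ⟨∑ v with b v = i, actV T v • x, sum_mem fun v hv => ?_⟩, ?_⟩
  · intro j hj a ha
    by_cases h0 : a = 0
    · rw [h0, vtx_zero, hsrc]
    · refine actV_smul_actV_of_ne ?_ x
      rintro rfl
      refine hj ?_
      simpa [b, vtx_of_lt j h0 ha] using hv
  · exact (Finset.sum_fiberwise _ _ _).trans ((toupieGen T).sum_e_smul x)

lemma SnkCogen.pdLeOne {X : ModuleCat.{u} (Alg T)ᵐᵒᵖ} (hX : SnkCogen T X)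
    (hz : ∀ i, seg T i 0 (T.ℓ i) = 0) : PdLeOne (Alg T)ᵐᵒᵖ X := by
  let := Module.compHom X (algebraMap k (Alg T)ᵐᵒᵖ)
  have : IsScalarTower k (Alg T)ᵐᵒᵖ X := IsScalarTower.of_algebraMap_smul fun _ _ => rfl
  have hsrc : ∀ x : X, actV T .src • x = 0 := hX.actV_src hz
  have hI : ∀ v, (toupieGen T).InjAt (∀ i, onBranch T X hsrc i) v := fun v =>
    AcyclicGen.InjAt.pi fun i => by
      refine (hX.of_injective (onBranch T X hsrc i).subtype
        Subtype.val_injective).injAt_of_supported hz i (fun j hj b hb x => ?_) v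
      exact Subtype.ext (x.2 j hj b hb)
  let f : (∀ i, onBranch T X hsrc i) →ₗ[(Alg T)ᵐᵒᵖ] X :=
    ∑ i, (onBranch T X hsrc i).subtype ∘ₗ LinearMap.proj i
  refine ⟨ModuleCat.of _ (∀ i, onBranch T X hsrc i), f, fun x => ?_, ?_, ?_⟩
  · obtain ⟨y, hy⟩ := exists_sum_onBranch hsrc x
    exact ⟨y, by simpa [f] using hy⟩
  · exact (toupieGen T).projective_of_injAt hI
  · exact (toupieGen T).projective_of_injAt fun v =>
      (hI v).of_injective (LinearMap.ker f).subtype Subtype.val_injective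

lemma snkCogen_of_indec {X : ModuleCat.{u} (Alg T)ᵐᵒᵖ} (hz : ∀ i, seg T i 0 (T.ℓ i) = 0)
    (hX : Indec (Alg T)ᵐᵒᵖ X) {x : X} (hx : actV T .snk • x ≠ 0) : SnkCogen T X := by
  let := Module.compHom X (algebraMap k (Alg T)ᵐᵒᵖ)
  have : IsScalarTower k (Alg T)ᵐᵒᵖ X := IsScalarTower.of_algebraMap_smul fun _ _ => rfl
  have hN := snkCogen_quotient (T := T) (X := X)
  obtain ⟨h, hh⟩ := (toupieGen T).exists_lift (snkKer T X).mkQ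
    (Submodule.mkQ_surjective _) LinearMap.id fun v => by
      by_cases hv : v = .snk
      · refine Or.inl fun w hw => ?_
        rw [Submodule.mkQ_apply, Submodule.Quotient.mk_eq_zero] at hw
        subst hv
        exact (actV_smul_actV _ _).symm.trans hw.actV_snk
      · exact Or.inr (hN.injAt_of_ne_snk hz hv)
  have hidem := hX.2 (h.comp (snkKer T X).mkQ)
    (LinearMap.ext fun y => congrArg h (hh ((snkKer T X).mkQ y)))
  rcases hidem with h0 | h1
  · refine absurd ?_ hx
    have h2 : h ((snkKer T X).mkQ x) = 0 := LinearMap.congr_fun h0 x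
    have h3 := hh ((snkKer T X).mkQ x)
    rw [h2, map_zero, LinearMap.id_apply, eq_comm, Submodule.mkQ_apply,
      Submodule.Quotient.mk_eq_zero] at h3
    exact h3.actV_snk
  · intro y hy
    have h2 : h ((snkKer T X).mkQ y) = y := LinearMap.congr_fun h1 y
    have h3 : (snkKer T X).mkQ y = 0 := (Submodule.Quotient.mk_eq_zero _).mpr hy
    rw [← h2, h3, map_zero]

end SnkCogen

/-! ### Propagation along paths -/

variable {X Y : ModuleCat.{u} (Alg T)ᵐᵒᵖ}

lemma Step.exists_actV_src (hz : ∀ i, seg T i 0 (T.ℓ i) = 0) (h : Step (Alg T)ᵐᵒᵖ X Y)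
    (hX : ∃ x : X, actV T .src • x ≠ 0) : ∃ y : Y, actV T .src • y ≠ 0 := by
  obtain ⟨hXi, -, -, -, f, hf, -⟩ := h
  obtain ⟨x, hx⟩ := hX
  by_contra! hY
  refine hf (LinearMap.ext fun y => ?_)
  obtain ⟨h1, h2⟩ := srcGen_of_indec hz hXi hx y
  refine eq_zero_of_actV (fun i a ha => ?_) (by rw [← f.map_smul, h2, f.map_zero])
  obtain ⟨z, hz'⟩ := h1 i a ha
  rw [← f.map_smul, hz', f.map_smul, ← seg_smul_actV, vtx_zero, hY, smul_zero]

lemma Step.exists_actV_snk (hz : ∀ i, seg T i 0 (T.ℓ i) = 0) (h : Step (Alg T)ᵐᵒᵖ X Y)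
    (hY : ∃ y : Y, actV T .snk • y ≠ 0) : ∃ x : X, actV T .snk • x ≠ 0 := by
  obtain ⟨-, -, hYi, -, f, hf, -⟩ := h
  obtain ⟨y, hy⟩ := hY
  by_contra! hX
  refine hf (LinearMap.ext fun x => ?_)
  refine snkCogen_of_indec hz hYi hy _ fun i a ha => ?_
  have hi := T.hℓ i
  rw [← f.map_smul, ← actV_smul_seg, vtx_of_le i (by omega) (by omega), hX, f.map_zero]

end Modules

section Interior

variable {k : Type u} [Field k] {T : ToupieAlg k}

lemma seg_smul_seg {X : Type*} [AddCommGroup X] [Module (Alg T)ᵐᵒᵖ X] (i : Fin T.t) (a m n : ℕ)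
    (x : X) : seg T i (a + m) n • seg T i a m • x = seg T i a (m + n) • x := by
  induction n with
  | zero => rw [seg, actV_smul_seg, add_zero]
  | succ n ih => rw [← arr_smul_seg, ih, add_assoc, arr_smul_seg, add_assoc]

lemma arr_smul_seg_of_ne {X : Type*} [AddCommGroup X] [Module (Alg T)ᵐᵒᵖ X] {i j : Fin T.t}
    {a b n : ℕ} (h : vtx T.t T.ℓ j b ≠ vtx T.t T.ℓ i (a + n)) (x : X) :
    arr T j b • seg T i a n • x = 0 := by
  rw [← actV_smul_seg, arr_smul_actV_of_ne h]

/-! ### Modules vanishing at the source and at the sink -/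

/-- The module `X` is the interval module of the vertices `a, …, a + n` of branch `i`, and is
generated by the component of `x` at the vertex `a`. -/
structure IsInterval (T : ToupieAlg k) (X : Type*) [AddCommGroup X] [Module (Alg T)ᵐᵒᵖ X]
    (i : Fin T.t) (a n : ℕ) (x : X) : Prop where
  ne_zero : a ≠ 0
  lt : a < T.ℓ i
  seg_ne : seg T i a n • x ≠ 0
  seg_eq : seg T i a (n + 1) • x = 0
  span : ∀ v (y : X), actV T v • y = 0 ∨ ∃ m ≤ n, v = vtx T.t T.ℓ i (a + m) ∧
    ∃ c : k, actV T v • y = algebraMap k (Alg T)ᵐᵒᵖ c • seg T i a m • x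

lemma algebraMap_smul_eq_zero {X : Type*} [AddCommGroup X] [Module (Alg T)ᵐᵒᵖ X] {c : k} {x : X}
    (hc : c ≠ 0) : algebraMap k (Alg T)ᵐᵒᵖ c • x = 0 ↔ x = 0 :=
  ((IsUnit.mk0 c hc).map (algebraMap k (Alg T)ᵐᵒᵖ)).smul_eq_zero

lemma smul_algebraMap_smul {X : Type*} [AddCommGroup X] [Module (Alg T)ᵐᵒᵖ X] (c : k)
    (r : (Alg T)ᵐᵒᵖ) (x : X) :
    r • algebraMap k (Alg T)ᵐᵒᵖ c • x = algebraMap k (Alg T)ᵐᵒᵖ c • r • x := by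
  rw [← mul_smul, ← mul_smul, Algebra.commutes]

/-- A nonzero non-isomorphism between interval modules moves towards the source. -/
lemma IsInterval.weight_lt {X Y : Type*} [AddCommGroup X] [Module (Alg T)ᵐᵒᵖ X] [AddCommGroup Y]
    [Module (Alg T)ᵐᵒᵖ Y] {i j : Fin T.t} {a b n p : ℕ} {x : X} {y : Y}
    (hX : IsInterval T X i a n x) (hY : IsInterval T Y j b p y) (f : X →ₗ[(Alg T)ᵐᵒᵖ] Y)
    (hf : f ≠ 0) (hbij : ¬ Function.Bijective f) : 2 * b + p < 2 * a + n := by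
  have hseg : ∀ m, f (seg T i a m • x) = seg T i a m • actV T (vtx T.t T.ℓ i a) • f x :=
    fun m => by rw [f.map_smul, seg_smul_actV]
  have hne : actV T (vtx T.t T.ℓ i a) • f x ≠ 0 := by
    intro h0
    refine hf (LinearMap.ext fun z => ?_)
    rw [← (toupieGen T).sum_e_smul z, map_sum]
    refine Finset.sum_eq_zero fun v _ => ?_
    change f (actV T v • z) = 0
    rcases hX.span v z with h | ⟨m, -, -, c, h⟩
    · rw [h, f.map_zero]
    · rw [h, f.map_smul, hseg, h0, smul_zero, smul_zero]
  rcases hY.span (vtx T.t T.ℓ i a) (f x) with h | ⟨m, hm, hv, c, hc⟩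
  · exact absurd h hne
  obtain ⟨rfl, hbm⟩ := (vtx_eq_iff hX.ne_zero hX.lt).mp hv.symm
  have hc0 : c ≠ 0 := by
    rintro rfl
    exact hne (by rw [hc, map_zero, zero_smul])
  have hfs : ∀ q, f (seg T j a q • x) = algebraMap k (Alg T)ᵐᵒᵖ c • seg T j b (m + q) • y :=
    fun q => by rw [hseg, hc, smul_algebraMap_smul, ← hbm, seg_smul_seg]
  have h1 : p ≤ m + n := by
    by_contra! hlt
    have h2 := hfs (n + 1)
    rw [hX.seg_eq, f.map_zero, eq_comm, algebraMap_smul_eq_zero hc0] at h2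
    refine hY.seg_ne ?_
    rw [show p = (m + (n + 1)) + (p - (m + (n + 1))) by omega, ← seg_smul_seg, h2, smul_zero]
  by_contra! hle
  obtain rfl : m = 0 := by omega
  obtain rfl : p = n := by omega
  obtain rfl : b = a := by omega
  simp only [zero_add] at hfs
  refine hbij ⟨(injective_iff_map_eq_zero f).mpr fun z hz => ?_, fun z => ?_⟩
  · rw [← (toupieGen T).sum_e_smul z]
    refine Finset.sum_eq_zero fun v _ => ?_
    change actV T v • z = 0
    rcases hX.span v z with h | ⟨q, hq, -, d, h⟩
    · exact h
    · by_cases hd : d = 0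
      · rw [h, hd, map_zero, zero_smul]
      · have h2 : f (actV T v • z) = 0 := by rw [f.map_smul, hz, smul_zero]
        rw [h, f.map_smul, hfs, algebraMap_smul_eq_zero hd, algebraMap_smul_eq_zero hc0] at h2
        refine absurd ?_ hY.seg_ne
        rw [← Nat.add_sub_cancel' hq, ← seg_smul_seg, h2, smul_zero]
  · change z ∈ LinearMap.range f
    rw [← (toupieGen T).sum_e_smul z]
    refine sum_mem fun v _ => ?_
    change actV T v • z ∈ LinearMap.range f
    rcases hY.span v z with h | ⟨q, hq, -, d, h⟩
    · rw [h]
      exact zero_mem _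
    · refine ⟨algebraMap k (Alg T)ᵐᵒᵖ (d * c⁻¹) • seg T j b q • x, ?_⟩
      rw [f.map_smul, hfs, h, ← mul_smul, ← map_mul, inv_mul_cancel_right₀ hc0]

/-- The projection of a module onto an interval submodule generated by `x`. -/
def intervalProj (T : ToupieAlg k) {X : Type*} [AddCommGroup X] [Module (Alg T)ᵐᵒᵖ X] [Module k X]
    [IsScalarTower k (Alg T)ᵐᵒᵖ X] (i : Fin T.t) (a n : ℕ) (x : X) (φ : X →ₗ[k] k) : X →ₗ[k] X :=
  ∑ m ∈ Finset.range (n + 1), LinearMap.toSpanSingleton k X (seg T i a m • x) ∘ₗ φ ∘ₗ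
    Algebra.lsmul k k X (seg T i (a + m) (n - m))

section IntervalProj

variable {X : Type*} [AddCommGroup X] [Module (Alg T)ᵐᵒᵖ X] [Module k X]
  [IsScalarTower k (Alg T)ᵐᵒᵖ X]

lemma intervalProj_apply (i : Fin T.t) (a n : ℕ) (x : X) (φ : X →ₗ[k] k) (y : X) :
    intervalProj T i a n x φ y =
      ∑ m ∈ Finset.range (n + 1), φ (seg T i (a + m) (n - m) • y) • seg T i a m • x := by
  simp [intervalProj]

lemma exists_intervalProj {i : Fin T.t} {a n : ℕ} (h0 : a ≠ 0) (hn : a + n < T.ℓ i)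
    (hmax : ∀ b (y : X), seg T i b (n + 1) • y = 0) (x : X) (φ : X →ₗ[k] k) :
    ∃ r : X →ₗ[(Alg T)ᵐᵒᵖ] X, ∀ y, r y = intervalProj T i a n x φ y := by
  refine (toupieGen T).exists_linearMap _ (fun v y => ?_) ?_
  · rw [intervalProj_apply, intervalProj_apply, Finset.smul_sum]
    refine Finset.sum_congr rfl fun m _ => ?_
    change φ (seg T i (a + m) (n - m) • actV T v • y) • seg T i a m • x =
      actV T v • φ (seg T i (a + m) (n - m) • y) • seg T i a m • x
    rw [smul_algebra_smul_comm]
    by_cases hv : vtx T.t T.ℓ i (a + m) = v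
    · rw [← hv, seg_smul_actV, actV_smul_seg]
    · rw [seg_smul_actV_of_ne hv, map_zero, zero_smul, actV_smul_seg_of_ne (Ne.symm hv), smul_zero]
  · rintro ⟨j, c, hc⟩ y
    rw [intervalProj_apply, intervalProj_apply, Finset.smul_sum]
    change ∑ m ∈ Finset.range (n + 1),
        φ (seg T i (a + m) (n - m) • arr T j c • y) • seg T i a m • x =
      ∑ m ∈ Finset.range (n + 1),
        arr T j c • φ (seg T i (a + m) (n - m) • y) • seg T i a m • x
    rw [Finset.sum_range_succ', Finset.sum_range_succ]
    have hfirst : seg T i (a + 0) (n - 0) • arr T j c • y = 0 := by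
      by_cases hv : vtx T.t T.ℓ i a = vtx T.t T.ℓ j (c + 1)
      · obtain ⟨rfl, rfl⟩ := (vtx_eq_iff h0 (by omega)).mp hv.symm
        exact (seg_smul_arr _ _ _ _).trans (hmax _ _)
      · exact seg_smul_arr_of_ne hv _
    have hlast : arr T j c • seg T i a n • x = 0 := by
      by_cases hv : vtx T.t T.ℓ j c = vtx T.t T.ℓ i (a + n)
      · obtain ⟨rfl, rfl⟩ := (vtx_eq_iff (by omega) hn).mp hv
        rw [arr_smul_seg, hmax]
      · exact arr_smul_seg_of_ne hv _
    rw [hfirst, map_zero, zero_smul, smul_algebra_smul_comm (φ _), hlast, smul_zero]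
    congr 1
    refine Finset.sum_congr rfl fun m hm => ?_
    have hmn := Finset.mem_range.mp hm
    rw [smul_algebra_smul_comm]
    by_cases hv : vtx T.t T.ℓ j c = vtx T.t T.ℓ i (a + m)
    · obtain ⟨rfl, rfl⟩ := (vtx_eq_iff (by omega) (by omega)).mp hv
      rw [arr_smul_seg, ← add_assoc, seg_smul_arr, show n - (m + 1) + 1 = n - m by omega]
    · rw [arr_smul_seg_of_ne hv, seg_smul_arr_of_ne, map_zero, zero_smul, smul_zero]
      intro h
      obtain ⟨rfl, hcm⟩ := (vtx_eq_iff (by omega) (by omega)).mp h.symm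
      exact hv (by rw [show c = a + m by omega])

end IntervalProj

lemma exists_seg_max {X : Type*} [AddCommGroup X] [Module (Alg T)ᵐᵒᵖ X] [Nontrivial X]
    (hsnk : ∀ x : X, actV T .snk • x = 0) :
    ∃ n, (∃ i a, ∃ x : X, seg T i a n • x ≠ 0) ∧ ∀ i a, ∀ x : X, seg T i a (n + 1) • x = 0 := by
  let P : ℕ → Prop := fun n => ∃ i a, ∃ x : X, seg T i a n • x ≠ 0
  have hP0 : P 0 := by
    obtain ⟨x, hx⟩ := exists_ne (0 : X)
    by_contra h
    refine hx (eq_zero_of_actV (fun i a _ => ?_) (hsnk x))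
    by_contra h'
    exact h ⟨i, a, x, h'⟩
  have hbound : ∀ n, P n → n ≤ ∑ i, T.ℓ i := by
    rintro n ⟨i, a, x, hx⟩
    have hle : T.ℓ i ≤ ∑ i, T.ℓ i := Finset.single_le_sum (fun _ _ => Nat.zero_le _)
      (Finset.mem_univ i)
    by_contra hn
    exact hx (by rw [seg_eq_zero_of_lt T i (by omega) (by omega), zero_smul])
  refine ⟨Nat.findGreatest P (∑ i, T.ℓ i), Nat.findGreatest_spec (Nat.zero_le _) hP0, ?_⟩
  intro i a x
  by_contra h
  have hP : P (Nat.findGreatest P (∑ i, T.ℓ i) + 1) := ⟨i, a, x, h⟩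
  exact Nat.findGreatest_is_greatest (Nat.lt_succ_self _) (hbound _ hP) hP

lemma exists_isInterval {X : ModuleCat.{u} (Alg T)ᵐᵒᵖ} (hX : Indec (Alg T)ᵐᵒᵖ X)
    (hsrc : ∀ x : X, actV T .src • x = 0) (hsnk : ∀ x : X, actV T .snk • x = 0) :
    ∃ i a n x, IsInterval T X i a n x := by
  let := Module.compHom X (algebraMap k (Alg T)ᵐᵒᵖ)
  have : IsScalarTower k (Alg T)ᵐᵒᵖ X := IsScalarTower.of_algebraMap_smul fun _ _ => rfl
  have := hX.1
  obtain ⟨n, ⟨i, a, x, hx⟩, hmax⟩ := exists_seg_max hsnk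
  have h0 : a ≠ 0 := by
    rintro rfl
    rw [← seg_smul_actV, vtx_zero, hsrc, smul_zero] at hx
    exact hx rfl
  have hn : a + n < T.ℓ i := by
    by_contra! hle
    rw [← actV_smul_seg, vtx_of_le i (by omega) hle, hsnk] at hx
    exact hx rfl
  obtain ⟨φ, hφ⟩ : ∃ φ : X →ₗ[k] k, φ (seg T i a n • x) = 1 := by
    obtain ⟨φ, hφ⟩ : ∃ φ : Module.Dual k X, φ (seg T i a n • x) ≠ 0 := by
      by_contra! h
      exact hx ((Module.forall_dual_apply_eq_zero_iff k _).mp h)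
    exact ⟨(φ (seg T i a n • x))⁻¹ • φ, by simp [hφ]⟩
  obtain ⟨r, hr⟩ := exists_intervalProj h0 hn (hmax i) x φ
  have hrx : r (actV T (vtx T.t T.ℓ i a) • x) = actV T (vtx T.t T.ℓ i a) • x := by
    rw [hr, intervalProj_apply, Finset.sum_eq_single_of_mem 0 (by simp)]
    · rw [add_zero, Nat.sub_zero, seg_smul_actV, hφ, one_smul, seg]
    · intro m _ hm
      rw [seg_smul_actV_of_ne, map_zero, zero_smul]
      intro h
      have := ((vtx_eq_iff h0 (by omega)).mp h).2
      omega
  have hrseg : ∀ m, r (seg T i a m • x) = seg T i a m • x := fun m => by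
    rw [← seg_smul_actV, r.map_smul, hrx]
  have hrk : ∀ (c : k) (y : X), r (c • y) = c • r y := fun c y => r.map_smul_of_tower c y
  have hid : r = LinearMap.id := by
    refine (hX.2 r (LinearMap.ext fun y => ?_)).resolve_left fun h => hx ?_
    · rw [LinearMap.comp_apply, hr y, intervalProj_apply, map_sum]
      exact Finset.sum_congr rfl fun m _ => by rw [hrk, hrseg]
    · rw [← hrseg, h, LinearMap.zero_apply]
  refine ⟨i, a, n, x, h0, by omega, hx, hmax i a x, fun v y => ?_⟩
  have hy : y = ∑ m ∈ Finset.range (n + 1), φ (seg T i (a + m) (n - m) • y) • seg T i a m • x := by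
    rw [← intervalProj_apply, ← hr, hid, LinearMap.id_apply]
  by_cases hv : ∃ m ≤ n, v = vtx T.t T.ℓ i (a + m)
  · obtain ⟨m, hm, rfl⟩ := hv
    refine Or.inr ⟨m, hm, rfl, φ (seg T i (a + m) (n - m) • y), ?_⟩
    rw [algebraMap_smul]
    conv_lhs => rw [hy]
    rw [Finset.smul_sum, Finset.sum_eq_single_of_mem m (by simpa using by omega)]
    · rw [smul_algebra_smul_comm, actV_smul_seg]
    · intro q _ hq
      rw [smul_algebra_smul_comm, actV_smul_seg_of_ne, smul_zero]
      intro h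
      have := ((vtx_eq_iff (by omega) (by omega)).mp h.symm).2
      omega
  · push Not at hv
    refine Or.inl ?_
    rw [hy, Finset.smul_sum]
    refine Finset.sum_eq_zero fun m hm => ?_
    rw [smul_algebra_smul_comm, actV_smul_seg_of_ne (hv m (by simpa [Nat.lt_succ_iff] using hm)),
      smul_zero]

/-- An indecomposable module vanishing at the source and at the sink is directed. -/
theorem directed_of_interior (hz : ∀ i, seg T i 0 (T.ℓ i) = 0) {M : ModuleCat.{u} (Alg T)ᵐᵒᵖ}
    (hM : Indec (Alg T)ᵐᵒᵖ M) (hsrc : ∀ x : M, actV T .src • x = 0)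
    (hsnk : ∀ x : M, actV T .snk • x = 0) : Directed (Alg T)ᵐᵒᵖ M := by
  intro hcycle
  obtain ⟨j, b, p, y, hY⟩ := exists_isInterval hM hsrc hsnk
  have key : ∀ X, Relation.TransGen (Step (Alg T)ᵐᵒᵖ) X M → (∀ x : X, actV T .snk • x = 0) →
      (∀ x : X, actV T .src • x = 0) ∧ ∀ (i : Fin T.t) (a n : ℕ) (x : X),
        IsInterval T X i a n x → 2 * b + p < 2 * a + n := by
    intro X hXM
    induction hXM using Relation.TransGen.head_induction_on with
    | single h =>
      intro _
      refine ⟨?_, fun i a n x hx => ?_⟩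
      · by_contra! hne
        obtain ⟨z, hne⟩ := h.exists_actV_src hz hne
        exact hne (hsrc z)
      · obtain ⟨-, -, -, -, f, hf, hbij⟩ := h
        exact hx.weight_lt hY f hf hbij
    | @head X W h _ ih =>
      intro hX
      have hW : ∀ w : W, actV T .snk • w = 0 := by
        by_contra! hne
        obtain ⟨z, hne⟩ := h.exists_actV_snk hz hne
        exact hne (hX z)
      obtain ⟨hW', hlt⟩ := ih hW
      refine ⟨?_, fun i a n x hx => ?_⟩
      · by_contra! hne
        obtain ⟨z, hne⟩ := h.exists_actV_src hz hne
        exact hne (hW' z)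
      · obtain ⟨-, -, hWi, -, f, hf, hbij⟩ := h
        obtain ⟨i', a', n', w, hw⟩ := exists_isInterval hWi hW' hW
        exact (hlt i' a' n' w hw).trans (hx.weight_lt hw f hf hbij)
  exact lt_irrefl _ ((key M hcycle hsnk).2 j b p y hY)

end Interior

lemma IndPath.exists_actV_src {k : Type u} [Field k] {T : ToupieAlg k}
    (hz : ∀ i, seg T i 0 (T.ℓ i) = 0) {X Y : ModuleCat.{u} (Alg T)ᵐᵒᵖ}
    (h : IndPath (Alg T)ᵐᵒᵖ X Y) (hX : ∃ x : X, actV T .src • x ≠ 0) :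
    ∃ y : Y, actV T .src • y ≠ 0 := by
  induction h with
  | refl => exact hX
  | tail _ hs ih => exact hs.exists_actV_src hz ih

lemma IndPath.exists_actV_snk {k : Type u} [Field k] {T : ToupieAlg k}
    (hz : ∀ i, seg T i 0 (T.ℓ i) = 0) {X Y : ModuleCat.{u} (Alg T)ᵐᵒᵖ}
    (h : IndPath (Alg T)ᵐᵒᵖ X Y) (hY : ∃ y : Y, actV T .snk • y ≠ 0) :
    ∃ x : X, actV T .snk • x ≠ 0 := by
  induction h using Relation.ReflTransGen.head_induction_on with
  | refl => exact hY
  | head hs _ ih => exact hs.exists_actV_snk hz ih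

/-- A non simply connected toupie algebra with `dim_k e₀ A e∞ = 0` is
weakly shod. -/
theorem weaklyShod_of_not_simplyConnected_of_mDim_zero {k : Type u} [Field k]
    (T : ToupieAlg k) (hnsc : ¬ SimplyConnected T) (hm : mDim T = 0) :
    WeaklyShod (Alg T)ᵐᵒᵖ := by
  have hz := seg_branch_eq_zero T hm
  intro M hM hfd hL hR
  by_cases hsrc : ∀ x : M, actV T .src • x = 0
  · by_cases hsnk : ∀ x : M, actV T .snk • x = 0
    · exact directed_of_interior hz hM hsrc hsnk
    · refine absurd ⟨hM, hfd, fun X hX _ hXM => ?_⟩ hL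
      obtain ⟨x, hx⟩ := hXM.exists_actV_snk hz (not_forall.mp hsnk)
      exact (snkCogen_of_indec hz hX hx).pdLeOne hz
  · refine absurd ⟨hM, hfd, fun X hX _ hMX => ?_⟩ hR
    obtain ⟨x, hx⟩ := hMX.exists_actV_src hz (not_forall.mp hsrc)
    exact (srcGen_of_indec hz hX hx).idLeOne

end Toupie
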